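/- arXiv:0706.2958 — 2 statements merged into one kernel-verified Lean document; each statement's English description precedes it below -/
import Mathlib

section
/- If a topological space is the union of an increasing sequence of open subsets each homeomorphic to ℝ^m, then the space itself is homeomorphic to ℝ^m (M. Brown's theorem, used for m = n-1). -/
theorem brown_rho (a b c : ℝ) (ha : 0 < a) (hab : a < b) (hc : 0 < c) (hc1 : c ≤ 1) :
    ∃ ρ : ℝ ≃o ℝ, (∀ t, t ≤ a → ρ t = c * t) ∧ (∀ t, b ≤ t → ρ t = t) := by
  have hba : 0 < b - a := by linarith
  obtain ⟨k, hk⟩ : ∃ k : ℝ, k * (b - a) = b - c * a := ⟨(b - c * a) / (b - a), by field_simp⟩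
  have hca : c * a ≤ a := by nlinarith
  have hk1 : 1 ≤ k := by
    by_contra h
    push Not at h
    nlinarith
  let f : ℝ → ℝ := fun t => max (c * t) (min t (c * a + k * (t - a)))
  have h1 : ∀ t, t ≤ a → f t = c * t := by
    intro t ht
    have : c * a + k * (t - a) ≤ c * t := by nlinarith
    exact max_eq_left (le_trans (min_le_right _ _) this)
  have h2 : ∀ t, b ≤ t → f t = t := by
    intro t ht
    have e1 : t ≤ c * a + k * (t - a) := by nlinarith
    have e2 : c * t ≤ t := by nlinarith
    simp only [f]
    rw [min_eq_left e1, max_eq_right e2]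
  have hm : StrictMono f := by
    intro x y hxy
    have e1 : c * x < c * y := by nlinarith
    have e2 : c * a + k * (x - a) < c * a + k * (y - a) := by nlinarith
    exact max_lt_max e1 (min_lt_min hxy e2)
  have hcont : Continuous f := by fun_prop
  have hs : Function.Surjective f := by
    apply hcont.surjective
    · apply Filter.tendsto_atTop_mono (f := fun t => c * t)
      · intro t; exact le_max_left _ _
      · exact Filter.tendsto_id.const_mul_atTop hc
    · have : Filter.Tendsto (fun t => c * t) Filter.atBot Filter.atBot :=
        Filter.tendsto_id.const_mul_atBot hc
      refine this.congr' ?_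
      filter_upwards [Filter.eventually_le_atBot a] with t ht
      exact (h1 t ht).symm
  exact ⟨StrictMono.orderIsoOfSurjective f hm hs, h1, h2⟩

section
variable {E : Type*} [NormedAddCommGroup E] [NormedSpace ℝ E]

noncomputable def brownRad (ρ : ℝ ≃o ℝ) (x : E) : E := (ρ ‖x‖ / ‖x‖) • x

theorem brownRad_zero (ρ : ℝ ≃o ℝ) : brownRad ρ (0 : E) = 0 := by simp [brownRad]

theorem brownRad_norm (ρ : ℝ ≃o ℝ) (h0 : ρ 0 = 0) (x : E) : ‖brownRad ρ x‖ = ρ ‖x‖ := by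
  by_cases hx : x = 0
  · simp [hx, brownRad, h0]
  · have : 0 < ‖x‖ := norm_pos_iff.2 hx
    have h2 : 0 ≤ ρ ‖x‖ := by rw [← h0]; exact ρ.monotone this.le
    rw [brownRad, norm_smul, Real.norm_of_nonneg (by positivity)]
    field_simp

theorem brownRad_inv (ρ : ℝ ≃o ℝ) (h0 : ρ 0 = 0) (x : E) :
    brownRad ρ.symm (brownRad ρ x) = x := by
  by_cases hx : x = 0
  · simp [hx, brownRad]
  · have h1 : 0 < ‖x‖ := norm_pos_iff.2 hx
    have h2 : 0 < ρ ‖x‖ := by rw [← h0]; exact ρ.strictMono h1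
    rw [brownRad, brownRad_norm ρ h0, brownRad, smul_smul]
    simp only [OrderIso.symm_apply_apply]
    have : ‖x‖ / ρ ‖x‖ * (ρ ‖x‖ / ‖x‖) = 1 := by field_simp
    rw [this, one_smul]

theorem brownRad_cont (ρ : ℝ ≃o ℝ) (h0 : ρ 0 = 0) : Continuous (brownRad ρ : E → E) := by
  rw [continuous_iff_continuousAt]
  intro x
  by_cases hx : x = 0
  · subst hx
    rw [ContinuousAt, brownRad_zero, tendsto_zero_iff_norm_tendsto_zero]
    simp only [brownRad_norm ρ h0]
    have : Continuous fun x : E => ρ ‖x‖ := ρ.continuous.comp continuous_norm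
    simpa [h0] using this.tendsto 0
  · have h1 : ‖x‖ ≠ 0 := norm_ne_zero_iff.2 hx
    have : Continuous fun x : E => ρ ‖x‖ := ρ.continuous.comp continuous_norm
    exact (this.continuousAt.div continuous_norm.continuousAt h1).smul continuousAt_id

theorem brown_tau (a b c : ℝ) (ha : 0 < a) (hab : a < b) (hc : 0 < c) (hc1 : c ≤ 1) :
    ∃ F : E ≃ₜ E, (∀ x, ‖x‖ ≤ a → F x = c • x) ∧ (∀ x, b ≤ ‖x‖ → F x = x) := by
  obtain ⟨ρ, h1, h2⟩ := brown_rho a b c ha hab hc hc1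
  have h0 : ρ 0 = 0 := by rw [h1 0 ha.le, mul_zero]
  have h0' : ρ.symm 0 = 0 := by rw [OrderIso.symm_apply_eq, h0]
  refine ⟨⟨⟨brownRad ρ, brownRad ρ.symm, brownRad_inv ρ h0, brownRad_inv ρ.symm h0'⟩,
    brownRad_cont ρ h0, brownRad_cont ρ.symm h0'⟩, ?_, ?_⟩
  · intro x hx
    change brownRad ρ x = _
    by_cases hx0 : x = 0
    · simp [hx0, brownRad]
    · have : ‖x‖ ≠ 0 := norm_ne_zero_iff.2 hx0
      rw [brownRad, h1 _ hx, mul_div_cancel_right₀ _ this]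
  · intro x hx
    change brownRad ρ x = _
    have : ‖x‖ ≠ 0 := by linarith
    rw [brownRad, h2 _ hx, div_self this, one_smul]

/-- elements outside the support ball are fixed, so the ball is preserved -/
theorem brown_ball (b : ℝ) (F : E ≃ₜ E) (h : ∀ x, b ≤ ‖x‖ → F x = x) (x : E) (hx : ‖x‖ ≤ b) :
    ‖F x‖ ≤ b ∧ ‖F.symm x‖ ≤ b := by
  constructor
  · by_contra hc
    push Not at hc
    have := F.injective (h _ hc.le)
    rw [this] at hc
    linarith
  · by_contra hc
    push Not at hc
    have := h _ hc.le
    rw [F.apply_symm_apply] at this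
    rw [← this] at hc
    linarith

open Classical in
noncomputable def brownExt (h : E → E) (σ : E → E) (y : E) : E :=
  if hy : ∃ x, h x = y then h (σ hy.choose) else y

theorem brownExt_apply (h : E → E) (hi : Function.Injective h) (σ : E → E) (x : E) :
    brownExt h σ (h x) = h (σ x) := by
  have hy : ∃ x', h x' = h x := ⟨x, rfl⟩
  rw [brownExt, dif_pos hy, hi hy.choose_spec]

theorem brownExt_not (h : E → E) (σ : E → E) (y : E) (hy : ¬ ∃ x, h x = y) :
    brownExt h σ y = y := by
  rw [brownExt, dif_neg hy]

theorem brownExt_inv (h : E → E) (hi : Function.Injective h) (σ τ : E → E)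
    (hl : ∀ x, τ (σ x) = x) (y : E) : brownExt h τ (brownExt h σ y) = y := by
  by_cases hy : ∃ x, h x = y
  · obtain ⟨x, rfl⟩ := hy
    rw [brownExt_apply h hi, brownExt_apply h hi, hl]
  · rw [brownExt_not h σ y hy, brownExt_not h τ y hy]

theorem brownExt_cont [ProperSpace E] (h : E → E) (ho : Topology.IsOpenEmbedding h) (σ : E → E)
    (hσ : Continuous σ) (s : ℝ) (hs : ∀ x, s ≤ ‖x‖ → σ x = x) :
    Continuous (brownExt h σ) := by
  rw [continuous_iff_continuousAt]
  intro y
  by_cases hy : ∃ x, h x = y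
  · obtain ⟨x, rfl⟩ := hy
    rw [← ho.continuousAt_iff]
    have : brownExt h σ ∘ h = h ∘ σ := by
      funext z; exact brownExt_apply h ho.injective σ z
    rw [this]
    exact (ho.continuous.comp hσ).continuousAt
  · have hcl : IsClosed (h '' Metric.closedBall 0 s) :=
      ((isCompact_closedBall _ _).image ho.continuous).isClosed
    have hmem : (h '' Metric.closedBall 0 s)ᶜ ∈ nhds y := by
      apply hcl.isOpen_compl.mem_nhds
      rintro ⟨x, -, hx⟩
      exact hy ⟨x, hx⟩
    refine continuousAt_id.congr ?_
    filter_upwards [hmem] with z hz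
    by_cases hz' : ∃ x, h x = z
    · obtain ⟨x, rfl⟩ := hz'
      rw [brownExt_apply h ho.injective, hs]
      · rfl
      · by_contra hc
        push Not at hc
        exact hz ⟨x, by simpa using hc.le, rfl⟩
    · rw [brownExt_not h σ z hz']; rfl

theorem brown_key0 [ProperSpace E] (h : E → E) (ho : Topology.IsOpenEmbedding h) (h0 : h 0 = 0)
    (r s : ℝ) (hr : 0 < r) (hrs : r < s) (K : Set E) (hK : IsCompact K) :
    ∃ h' : E → E, Topology.IsOpenEmbedding h' ∧ (∀ x, ‖x‖ ≤ r → h' x = h x) ∧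
      K ⊆ h' '' Metric.closedBall 0 s := by
  have hs : 0 < s := hr.trans hrs
  obtain ⟨ε, hε, hεs⟩ : ∃ ε > 0, Metric.closedBall (0 : E) ε ⊆ h '' Metric.ball 0 s := by
    apply Metric.nhds_basis_closedBall.mem_iff.1
    apply (ho.isOpenMap _ Metric.isOpen_ball).mem_nhds
    exact ⟨0, by simpa using hs, h0⟩
  obtain ⟨δ, hδ, hδr, hδε⟩ : ∃ δ > 0, δ ≤ r ∧ ∀ x, ‖x‖ ≤ δ → ‖h x‖ ≤ ε / 2 := by
    have : h ⁻¹' Metric.closedBall 0 (ε / 2) ∈ nhds (0 : E) := by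
      apply ho.continuous.continuousAt
      rw [h0]
      exact Metric.closedBall_mem_nhds _ (by positivity)
    obtain ⟨δ, hδ, hh⟩ := Metric.nhds_basis_closedBall.mem_iff.1 this
    refine ⟨min δ r, lt_min hδ hr, min_le_right _ _, fun x hx => ?_⟩
    have := hh (show x ∈ Metric.closedBall 0 δ by simpa using hx.trans (min_le_left _ _))
    simpa using this
  obtain ⟨R, hRε, hRK, hRs⟩ : ∃ R, ε ≤ R ∧ (∀ y ∈ K, ‖y‖ ≤ R) ∧ (∀ x, ‖x‖ ≤ s → ‖h x‖ ≤ R) := by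
    obtain ⟨A, hA⟩ := hK.isBounded.exists_norm_le
    obtain ⟨B, hB⟩ :=
      ((isCompact_closedBall (0 : E) s).image ho.continuous).isBounded.exists_norm_le
    refine ⟨max ε (max A B), le_max_left _ _, fun y hy => ?_, fun x hx => ?_⟩
    · exact (hA y hy).trans ((le_max_left _ _).trans (le_max_right _ _))
    · exact (hB _ ⟨x, by simpa using hx, rfl⟩).trans ((le_max_right _ _).trans (le_max_right _ _))
  have hR : 0 < R := hε.trans_le hRε
  obtain ⟨σ, σ1, σ2⟩ := brown_tau (E := E) r s (δ / r) hr hrs (by positivity)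
    ((div_le_one hr).2 hδr)
  obtain ⟨τ, τ1, τ2⟩ := brown_tau (E := E) (ε / 2) ε (ε / R) (by positivity) (by linarith)
    (by positivity) ((div_le_one hR).2 hRε)
  have σ2' : ∀ x, s ≤ ‖x‖ → σ.symm x = x := fun x hx => by
    rw [Homeomorph.symm_apply_eq, σ2 x hx]
  let φ : E ≃ₜ E := ⟨⟨brownExt h σ, brownExt h σ.symm,
      brownExt_inv h ho.injective _ _ σ.symm_apply_apply,
      brownExt_inv h ho.injective _ _ σ.apply_symm_apply⟩,
      brownExt_cont h ho σ σ.continuous s σ2, brownExt_cont h ho σ.symm σ.symm.continuous s σ2'⟩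
  have hφ : ∀ x, φ (h x) = h (σ x) := brownExt_apply h ho.injective σ
  have hφR : ∀ y, ‖y‖ ≤ R → ‖φ y‖ ≤ R := by
    intro y hy
    by_cases hy' : ∃ x, h x = y
    · obtain ⟨x, rfl⟩ := hy'
      rw [hφ]
      rcases le_total ‖x‖ s with hx | hx
      · exact hRs _ (brown_ball s σ σ2 x hx).1
      · rwa [σ2 x hx]
    · have : φ y = y := brownExt_not h σ y hy'
      rwa [this]
  let ψ : E ≃ₜ E := τ.trans (Homeomorph.smulOfNeZero (R / ε) (by positivity))
  have hψ : ∀ x, ψ x = (R / ε) • τ x := fun x => rfl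
  have hRe : R / ε * (ε / R) = 1 := by field_simp
  refine ⟨fun x => φ.symm (ψ (h (σ x))), ?_, ?_, ?_⟩
  · exact φ.symm.isOpenEmbedding.comp (ψ.isOpenEmbedding.comp (ho.comp σ.isOpenEmbedding))
  · intro x hx
    have e1 : ‖h (σ x)‖ ≤ ε / 2 := by
      apply hδε
      rw [σ1 x hx, norm_smul, Real.norm_of_nonneg (by positivity), div_mul_eq_mul_div,
        div_le_iff₀ hr]
      gcongr
    have e2 : ψ (h (σ x)) = h (σ x) := by
      rw [hψ, τ1 _ e1, smul_smul, hRe, one_smul]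
    change φ.symm (ψ (h (σ x))) = h x
    rw [e2, Homeomorph.symm_apply_eq, hφ]
  · intro y hy
    have e1 := hφR y (hRK y hy)
    have e2 : ‖(ε / R) • φ y‖ ≤ ε := by
      rw [norm_smul, Real.norm_of_nonneg (by positivity), div_mul_eq_mul_div, div_le_iff₀ hR]
      gcongr
    have e3 := (brown_ball ε τ τ2 _ e2).2
    obtain ⟨w, hw, hwz⟩ := hεs (show _ ∈ Metric.closedBall (0 : E) ε by simpa using e3)
    have hw' : ‖w‖ ≤ s := by
      have : ‖w‖ < s := by simpa using hw
      exact this.le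
    refine ⟨σ.symm w, by simpa using (brown_ball s σ σ2 w hw').2, ?_⟩
    change φ.symm (ψ (h (σ (σ.symm w)))) = y
    rw [σ.apply_symm_apply, hwz, hψ, τ.apply_symm_apply, smul_smul, hRe, one_smul,
      φ.symm_apply_apply]

theorem brown_key [ProperSpace E] (h : E → E) (ho : Topology.IsOpenEmbedding h)
    (r s : ℝ) (hr : 0 < r) (hrs : r < s) (K : Set E) (hK : IsCompact K) :
    ∃ h' : E → E, Topology.IsOpenEmbedding h' ∧ (∀ x, ‖x‖ ≤ r → h' x = h x) ∧
      K ⊆ h' '' Metric.closedBall 0 s := by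
  let T : E ≃ₜ E := Homeomorph.addRight (h 0)
  have hT : ∀ x, T x = x + h 0 := fun x => rfl
  obtain ⟨g, g1, g2, g3⟩ := brown_key0 (T.symm ∘ h) (T.symm.isOpenEmbedding.comp ho)
    (by simp [Homeomorph.symm_apply_eq, hT]) r s hr hrs (T.symm '' K) (hK.image T.symm.continuous)
  refine ⟨T ∘ g, T.isOpenEmbedding.comp g1, ?_, ?_⟩
  · intro x hx
    simp [g2 x hx]
  · intro y hy
    obtain ⟨x, hx, hxy⟩ := g3 ⟨y, hy, rfl⟩
    exact ⟨x, hx, by simp [hxy]⟩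

theorem brown_step [ProperSpace E] {X : Type*} [TopologicalSpace X] (U V : Set X) (hUV : U ⊆ V)
    (hV : IsOpen V) (e : V ≃ₜ E) (f : E → X) (hf : Topology.IsOpenEmbedding f)
    (hfU : ∀ x, f x ∈ U) (r s : ℝ) (hr : 0 < r) (hrs : r < s)
    (K : Set X) (hK : IsCompact K) (hKV : K ⊆ V) :
    ∃ f' : E → X, (Topology.IsOpenEmbedding f' ∧ ∀ x, f' x ∈ V) ∧ (∀ x, ‖x‖ ≤ r → f' x = f x) ∧
      K ⊆ f' '' Metric.closedBall 0 s := by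
  have hval : Topology.IsOpenEmbedding (Subtype.val : V → X) := hV.isOpenEmbedding_subtypeVal
  let g : E → V := fun x => ⟨f x, hUV (hfU x)⟩
  have hg : Topology.IsOpenEmbedding g := Topology.IsOpenEmbedding.of_comp g hval hf
  have hK' : IsCompact (Subtype.val ⁻¹' K : Set V) := by
    rw [hval.isInducing.isCompact_iff, Subtype.image_preimage_coe, Set.inter_eq_right.2 hKV]
    exact hK
  obtain ⟨h', a, b, c⟩ := brown_key (e ∘ g) (e.isOpenEmbedding.comp hg) r s hr hrs _
    (hK'.image e.continuous)
  refine ⟨fun x => (e.symm (h' x)).1, ⟨hval.comp (e.symm.isOpenEmbedding.comp a),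
    fun x => (e.symm (h' x)).2⟩, ?_, ?_⟩
  · intro x hx
    simp [b x hx, g]
  · intro y hy
    obtain ⟨x, hx, hxy⟩ := c ⟨⟨y, hKV hy⟩, hy, rfl⟩
    exact ⟨x, hx, by simp [hxy]⟩

end

/-- M. Brown's monotone union theorem: a space which is the union of an increasing
sequence of open subsets, each homeomorphic to `ℝ^m`, is itself homeomorphic to `ℝ^m`. -/
theorem brown_monotone_union {X : Type*} [TopologicalSpace X] (m : ℕ)
    (U : ℕ → Set X) (hmono : Monotone U) (hopen : ∀ i, IsOpen (U i))
    (hhomeo : ∀ i, Nonempty (↥(U i) ≃ₜ EuclideanSpace ℝ (Fin m)))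
    (hunion : (⋃ i, U i) = Set.univ) :
    Nonempty (X ≃ₜ EuclideanSpace ℝ (Fin m)) := by
  let E := EuclideanSpace ℝ (Fin m)
  have e : ∀ i, U i ≃ₜ E := fun i => (hhomeo i).some
  let C : ℕ → ℕ → Set X := fun j n => (fun x : E => ((e j).symm x).1) '' Metric.closedBall 0 n
  let K : ℕ → Set X := fun n => ⋃ j ∈ Finset.range (n + 1), C j n
  have hK : ∀ n, IsCompact (K n) := fun n => (Finset.range (n + 1)).isCompact_biUnion fun j _ =>
    (isCompact_closedBall _ _).image (continuous_subtype_val.comp (e j).symm.continuous)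
  have hKU : ∀ n, K n ⊆ U n := by
    intro n y hy
    simp only [K, C, Set.mem_iUnion, Finset.mem_range] at hy
    obtain ⟨j, hj, x, -, rfl⟩ := hy
    exact hmono (by omega) ((e j).symm x).2
  have hcov : ∀ y, ∃ n, y ∈ K (n + 1) := by
    intro y
    have : y ∈ ⋃ i, U i := by rw [hunion]; trivial
    obtain ⟨j, hj⟩ := Set.mem_iUnion.1 this
    obtain ⟨k, hk⟩ := exists_nat_ge ‖e j ⟨y, hj⟩‖
    refine ⟨max j k, ?_⟩
    simp only [K, C, Set.mem_iUnion, Finset.mem_range]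
    refine ⟨j, by omega, e j ⟨y, hj⟩, ?_, by simp⟩
    rw [mem_closedBall_zero_iff]
    refine hk.trans ?_
    exact_mod_cast (le_max_right j k).trans (Nat.le_succ _)
  let P : ℕ → (E → X) → Prop := fun n f => Topology.IsOpenEmbedding f ∧ ∀ x, f x ∈ U n
  have step : ∀ n (f : {f // P n f}), ∃ f' : {f // P (n + 1) f},
      (∀ x, ‖x‖ ≤ (n : ℝ) + 1 → f'.1 x = f.1 x) ∧
      K (n + 1) ⊆ f'.1 '' Metric.closedBall 0 ((n : ℝ) + 2) := by
    intro n f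
    obtain ⟨f', a, b⟩ := brown_step (U n) (U (n + 1)) (hmono (Nat.le_succ n)) (hopen _) (e (n + 1))
      f.1 f.2.1 f.2.2 ((n : ℝ) + 1) ((n : ℝ) + 2) (by positivity) (by linarith) (K (n + 1)) (hK _)
      (hKU _)
    exact ⟨⟨f', a⟩, b⟩
  choose nxt hn1 hn2 using step
  let F0 : {f // P 0 f} := ⟨fun x => ((e 0).symm x).1,
    (hopen 0).isOpenEmbedding_subtypeVal.comp (e 0).symm.isOpenEmbedding,
    fun x => ((e 0).symm x).2⟩
  let F : ∀ n, {f // P n f} := fun n => Nat.rec F0 nxt n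
  have hF1 : ∀ (n : ℕ) (x : E), ‖x‖ ≤ (n : ℝ) + 1 → (F (n + 1)).1 x = (F n).1 x := fun n => hn1 n (F n)
  have hF2 : ∀ n, K (n + 1) ⊆ (F (n + 1)).1 '' Metric.closedBall 0 ((n : ℝ) + 2) :=
    fun n => hn2 n (F n)
  have hF3 : ∀ (n k : ℕ), n ≤ k → ∀ x : E, ‖x‖ ≤ (n : ℝ) + 1 → (F k).1 x = (F n).1 x := by
    intro n k hnk
    induction k, hnk using Nat.le_induction with
    | base => intro x _; rfl
    | succ k hk ih =>
      intro x hx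
      rw [← ih x hx]
      apply hF1
      have : (n : ℝ) ≤ k := by exact_mod_cast hk
      linarith
  let f : E → X := fun x => (F ⌈‖x‖⌉₊).1 x
  have hf : ∀ (n : ℕ) (x : E), ‖x‖ ≤ (n : ℝ) + 1 → f x = (F n).1 x := by
    intro n x hx
    rcases le_total n ⌈‖x‖⌉₊ with h | h
    · exact hF3 n _ h x hx
    · refine (hF3 _ n h x ?_).symm
      linarith [Nat.le_ceil ‖x‖]
  have hev : ∀ x, ∃ n, f =ᶠ[nhds x] (F n).1 := by
    intro x
    obtain ⟨n, hn⟩ := exists_nat_ge ‖x‖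
    refine ⟨n, ?_⟩
    have : Metric.ball (0 : E) (n + 1) ∈ nhds x :=
      Metric.isOpen_ball.mem_nhds (by rw [mem_ball_zero_iff]; linarith)
    filter_upwards [this] with z hz
    exact hf n z (mem_ball_zero_iff.1 hz).le
  have hcont : Continuous f := by
    rw [continuous_iff_continuousAt]
    intro x
    obtain ⟨n, hn⟩ := hev x
    exact (F n).2.1.continuous.continuousAt.congr hn.symm
  have hom : IsOpenMap f := by
    rw [isOpenMap_iff_nhds_le]
    intro x
    obtain ⟨n, hn⟩ := hev x
    rw [Filter.map_congr hn, hn.eq_of_nhds]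
    exact (F n).2.1.isOpenMap.nhds_le x
  have hinj : Function.Injective f := by
    intro x y hxy
    obtain ⟨n, hn⟩ := exists_nat_ge (max ‖x‖ ‖y‖)
    have h1 := (le_max_left _ _).trans hn
    have h2 := (le_max_right _ _).trans hn
    rw [hf n x (by linarith), hf n y (by linarith)] at hxy
    exact (F n).2.1.injective hxy
  have hsurj : Function.Surjective f := by
    intro y
    obtain ⟨n, hn⟩ := hcov y
    obtain ⟨x, hx, hxy⟩ := hF2 n hn
    refine ⟨x, ?_⟩
    rw [← hxy]
    refine hf (n + 1) x ?_
    have := mem_closedBall_zero_iff.1 hx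
    push_cast
    linarith
  exact ⟨((IsHomeomorph.mk hcont hom ⟨hinj, hsurj⟩).homeomorph f).symm⟩
end

section
/- If the shadow boundary S(K,x) is an (n-1)-dimensional manifold with boundary, then there exists λ < ∞ such that γ_λ(K,x) ⊆ S(K,x); equivalently, the lengths of the segments in which lines parallel to x meet S(K,x) are bounded below by a positive constant ε. -/
open Set Metric Pointwise

/-- The shadow boundary of `K` in direction `x`: boundary points `P` such that the line
`{P + t • x}` meets `K` but not the interior of `K`. -/
def shadowBoundary {n : ℕ} (K : Set (EuclideanSpace ℝ (Fin n)))
    (x : EuclideanSpace ℝ (Fin n)) : Set (EuclideanSpace ℝ (Fin n)) :=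
  {P | P ∈ frontier K ∧ (∃ t : ℝ, P + t • x ∈ K) ∧ ∀ t : ℝ, P + t • x ∉ interior K}

/-- The positive part `K⁺` of the boundary. -/
def posPart {n : ℕ} (K : Set (EuclideanSpace ℝ (Fin n)))
    (x : EuclideanSpace ℝ (Fin n)) : Set (EuclideanSpace ℝ (Fin n)) :=
  {y | y ∈ frontier K ∧ ∃ τ : ℝ, 0 < τ ∧ y - τ • x ∈ interior K}

/-- The negative part `K⁻` of the boundary. -/
def negPart {n : ℕ} (K : Set (EuclideanSpace ℝ (Fin n)))
    (x : EuclideanSpace ℝ (Fin n)) : Set (EuclideanSpace ℝ (Fin n)) :=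
  {y | y ∈ frontier K ∧ ∃ τ : ℝ, 0 < τ ∧ y + τ • x ∈ interior K}
/-- The critical parameter `λ₀`. -/
noncomputable def lambda0 {n : ℕ} (K : Set (EuclideanSpace ℝ (Fin n)))
    (x : EuclideanSpace ℝ (Fin n)) : ℝ :=
  sSup {t : ℝ | 0 < t ∧ (t • K) ∩ (x +ᵥ t • K) = ∅}

/-- The general parameter sphere `γ_λ(K,x)`. -/
noncomputable def paramSphere {n : ℕ} (K : Set (EuclideanSpace ℝ (Fin n)))
    (x : EuclideanSpace ℝ (Fin n)) (lam : ℝ) : Set (EuclideanSpace ℝ (Fin n)) :=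
  lam⁻¹ • (frontier (lam • K) ∩ frontier (x +ᵥ lam • K))


section BrouwerPart

lemma det_id_add_interp {E : Type*} [NormedAddCommGroup E] [NormedSpace ℝ E]
    [FiniteDimensional ℝ E] (s : Finset ℝ)
    (hs : Module.finrank ℝ E < s.card) (A : E →L[ℝ] E) (u : ℝ) :
    (ContinuousLinearMap.id ℝ E + u • A).det =
      ∑ t ∈ s, (Lagrange.basis s id t).eval u * (ContinuousLinearMap.id ℝ E + t • A).det := by
  classical
  let b := Module.finBasis ℝ E
  let M := LinearMap.toMatrix b b (A : E →ₗ[ℝ] E)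
  let p : Polynomial ℝ := ((Polynomial.X : Polynomial ℝ) • M.map Polynomial.C +
    (1 : Matrix (Fin (Module.finrank ℝ E)) (Fin (Module.finrank ℝ E)) ℝ).map Polynomial.C).det
  have hp : ∀ t : ℝ, (ContinuousLinearMap.id ℝ E + t • A).det = p.eval t := by
    intro t
    have h1 : (ContinuousLinearMap.id ℝ E + t • A).det = (1 + t • M).det := by
      rw [ContinuousLinearMap.det, ← LinearMap.det_toMatrix b]
      congr 1
      simp [M]
    rw [h1, ← Polynomial.coe_evalRingHom, RingHom.map_det]
    congr 1
    ext i j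
    simp [Matrix.one_apply]
    split_ifs <;> simp <;> ring
  have hd : p.degree < s.card := by
    refine lt_of_le_of_lt Polynomial.degree_le_natDegree ?_
    have := Polynomial.natDegree_det_X_add_C_le M
      (1 : Matrix (Fin (Module.finrank ℝ E)) (Fin (Module.finrank ℝ E)) ℝ)
    rw [Fintype.card_fin] at this
    exact_mod_cast lt_of_le_of_lt this hs
  have := Lagrange.eq_interpolate (v := id) (s := s) (f := p) (Set.injOn_id _) hd
  simp only [hp]
  conv_lhs => rw [this]
  rw [Lagrange.interpolate_apply, Polynomial.eval_finsetSum]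
  refine Finset.sum_congr rfl fun t _ => ?_
  simp [mul_comm]

lemma det_id_add_pos {E : Type*} [NormedAddCommGroup E] [NormedSpace ℝ E]
    [FiniteDimensional ℝ E] (A : E →L[ℝ] E) (hA : ‖A‖ < 1) :
    0 < (ContinuousLinearMap.id ℝ E + A).det := by
  have hne : ∀ t ∈ Set.Icc (0:ℝ) 1, (ContinuousLinearMap.id ℝ E + t • A).det ≠ 0 := by
    intro t ht h0
    have hn : ‖t • A‖ < 1 := by
      rw [norm_smul, Real.norm_of_nonneg ht.1]
      nlinarith [norm_nonneg A, ht.2]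
    have hk := LinearMap.bot_lt_ker_of_det_eq_zero h0
    obtain ⟨v, hv, hv0⟩ := Submodule.exists_mem_ne_zero_of_ne_bot hk.ne'
    have hv' : v + (t • A) v = 0 := by simpa using hv
    have : ‖v‖ = ‖(t • A) v‖ := by
      rw [← norm_neg ((t • A) v), ← eq_neg_of_add_eq_zero_left hv']
    have h2 := (t • A).le_opNorm v
    have := norm_pos_iff.2 hv0
    nlinarith
  by_contra hcon
  push Not at hcon
  have hc : ContinuousOn (fun t : ℝ => (ContinuousLinearMap.id ℝ E + t • A).det) (Set.Icc 0 1) := by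
    apply Continuous.continuousOn
    exact ContinuousLinearMap.continuous_det.comp (by fun_prop)
  have := intermediate_value_Icc' (zero_le_one) hc
  obtain ⟨t, ht, h0⟩ := this (show (0:ℝ) ∈ _ by
    constructor
    · simpa using hcon
    · simp [ContinuousLinearMap.det])
  exact hne t ht h0

theorem no_C1_retraction {E : Type*} [NormedAddCommGroup E] [InnerProductSpace ℝ E]
    [FiniteDimensional ℝ E] (r : E → E) (hr : ContDiff ℝ 1 r) (h1 : ∀ x, ‖r x‖ = 1)
    (h2 : ∀ x, ‖x‖ = 1 → r x = x) : False := by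
  classical
  let _ : MeasurableSpace E := borel E
  have : BorelSpace E := ⟨rfl⟩
  let μ : MeasureTheory.Measure E := MeasureTheory.volume
  let k : E → E := fun x => if ‖x‖ ≤ 1 then r x - x else 0
  have hrd : Differentiable ℝ r := hr.differentiable one_ne_zero
  have hk1 : ∀ x, 1 ≤ ‖x‖ → k x = 0 := by
    intro x hx
    by_cases h : ‖x‖ ≤ 1
    · simp [k, h2 x (le_antisymm h hx)]
    · simp [k, h]
  obtain ⟨L, hL⟩ : ∃ L, LipschitzOnWith L (fun x => r x - x) (closedBall (0:E) 1) :=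
    ContDiffOn.exists_lipschitzOnWith (n := 1) (hr.sub contDiff_id).contDiffOn one_ne_zero
      (convex_closedBall _ _) (isCompact_closedBall _ _)
  have hkL0 : ∀ x y, ‖x‖ ≤ 1 → ‖k x - k y‖ ≤ L * ‖x - y‖ := by
    intro x y hx
    by_cases hy : ‖y‖ ≤ 1
    · have := hL.norm_sub_le (x := x) (y := y) (by simpa using hx) (by simpa using hy)
      simpa [k, hx, hy] using this
    · push Not at hy
      obtain ⟨z, hz, hz1⟩ : ∃ z ∈ segment ℝ x y, ‖z‖ = 1 := by
        have hpc : IsPreconnected (segment ℝ x y) := (convex_segment x y).isPreconnected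
        have := hpc.intermediate_value (left_mem_segment ℝ x y) (right_mem_segment ℝ x y)
          continuous_norm.continuousOn
        obtain ⟨z, hz, h⟩ := this ⟨hx, hy.le⟩
        exact ⟨z, hz, h⟩
      have := hL.norm_sub_le (x := x) (y := z) (by simpa using hx) (by simp [hz1])
      rw [h2 z hz1, sub_self, sub_zero] at this
      rw [hk1 y hy.le, sub_zero]
      simp only [k, hx, if_true]
      refine this.trans (mul_le_mul_of_nonneg_left ?_ L.2)
      obtain ⟨θ, hθ, rfl⟩ := (segment_eq_image' ℝ x y ▸ hz)
      simp only [sub_add_cancel_left, norm_neg, norm_smul]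
      rw [norm_sub_rev y x, Real.norm_of_nonneg hθ.1]
      nlinarith [norm_nonneg (x - y), hθ.2]
  have hkL : ∀ x y, ‖k x - k y‖ ≤ L * ‖x - y‖ := by
    intro x y
    by_cases hx : ‖x‖ ≤ 1
    · exact hkL0 x y hx
    · by_cases hy : ‖y‖ ≤ 1
      · rw [norm_sub_rev, norm_sub_rev x]; exact hkL0 y x hy
      · push Not at hx hy
        rw [hk1 x hx.le, hk1 y hy.le]; simp; positivity
  let D : E → E →L[ℝ] E := fun x => fderiv ℝ r x - ContinuousLinearMap.id ℝ E
  have hkD : ∀ x ∈ ball (0:E) 1, HasFDerivAt k (D x) x := by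
    intro x hx
    have h := ((hrd x).hasFDerivAt.sub (hasFDerivAt_id x))
    refine h.congr_of_eventuallyEq ?_
    filter_upwards [isOpen_ball.mem_nhds hx] with y hy
    have : ‖y‖ ≤ 1 := by simpa using (mem_ball_zero_iff.1 hy).le
    simp [k, this]
  have hDn : ∀ x ∈ ball (0:E) 1, ‖D x‖ ≤ L := by
    intro x hx
    refine (hkD x hx).le_of_lip' L.2 ?_
    filter_upwards with y
    exact hkL y x
  -- small parameters
  have hsmall : ∀ t : ℝ, 0 ≤ t → t * L ≤ 1/2 →
      ∫ x in ball (0:E) 1, (ContinuousLinearMap.id ℝ E + t • D x).det ∂μ = μ.real (ball (0:E) 1) := by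
    intro t ht htL
    let g : E → E := fun x => x + t • k x
    have hA : ApproximatesLinearOn g ((ContinuousLinearEquiv.refl ℝ E : E ≃L[ℝ] E) : E →L[ℝ] E)
        univ (1/2) := by
      intro x _ y _
      have : g x - g y - ((ContinuousLinearEquiv.refl ℝ E : E ≃L[ℝ] E) : E →L[ℝ] E) (x - y)
          = t • (k x - k y) := by
        simp only [g, smul_sub, ContinuousLinearEquiv.coe_coe, ContinuousLinearEquiv.refl_apply]; abel
      rw [this, norm_smul, Real.norm_of_nonneg ht]
      calc t * ‖k x - k y‖ ≤ t * (L * ‖x - y‖) := by gcongr; exact hkL x y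
        _ = (t * L) * ‖x - y‖ := by ring
        _ ≤ (1/2) * ‖x - y‖ := by gcongr
        _ = _ := by simp
    have hc : Subsingleton E ∨ (1/2 : NNReal) <
        ‖((ContinuousLinearEquiv.refl ℝ E : E ≃L[ℝ] E).symm : E →L[ℝ] E)‖₊⁻¹ := by
      rcases subsingleton_or_nontrivial E with h | h
      · exact Or.inl h
      · right
        have : ‖((ContinuousLinearEquiv.refl ℝ E : E ≃L[ℝ] E).symm : E →L[ℝ] E)‖₊ = 1 := by
          ext
          exact ContinuousLinearMap.norm_id
        rw [this]
        rw [inv_one, ← NNReal.coe_lt_coe]; norm_num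
    have hsurj : Function.Surjective g := hA.surjective hc
    have hinj : Function.Injective g := Set.injOn_univ.1 (hA.injOn hc)
    have hid : ∀ x, 1 ≤ ‖x‖ → g x = x := fun x hx => by simp [g, hk1 x hx]
    have himg : g '' ball 0 1 = ball 0 1 := by
      ext y
      constructor
      · rintro ⟨x, hx, rfl⟩
        by_contra hcon
        have hy : 1 ≤ ‖g x‖ := by simpa using hcon
        have := hinj (hid _ hy)
        rw [this] at hcon
        exact hcon hx
      · intro hy
        obtain ⟨x, rfl⟩ := hsurj y
        refine ⟨x, ?_, rfl⟩
        by_contra hcon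
        have hx : 1 ≤ ‖x‖ := by simpa using hcon
        rw [hid x hx] at hy
        exact hcon hy
    have hder : ∀ x ∈ ball (0:E) 1, HasFDerivWithinAt g (ContinuousLinearMap.id ℝ E + t • D x)
        (ball 0 1) x := fun x hx =>
      ((hasFDerivAt_id x).add ((hkD x hx).const_smul t)).hasFDerivWithinAt
    have := MeasureTheory.integral_image_eq_integral_abs_det_fderiv_smul μ
      (measurableSet_ball (x := (0:E)) (ε := 1)) hder hinj.injOn (fun _ => (1:ℝ))
    rw [himg] at this
    simp only [smul_eq_mul, mul_one] at this
    rw [MeasureTheory.setIntegral_const, smul_eq_mul, mul_one] at this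
    rw [this]
    refine MeasureTheory.setIntegral_congr_fun measurableSet_ball fun x hx => ?_
    refine (abs_of_pos (det_id_add_pos _ ?_)).symm
    rw [norm_smul, Real.norm_of_nonneg ht]
    calc t * ‖D x‖ ≤ t * L := by gcongr; exact hDn x hx
      _ ≤ 1/2 := htL
      _ < 1 := by norm_num
  -- interpolation
  obtain ⟨s, hs, hcard⟩ : ∃ s : Finset ℝ, (↑s ⊆ Set.Icc (0:ℝ) (1 / (2 * (L + 1)))) ∧
      s.card = Module.finrank ℝ E + 1 :=
    (Set.Icc_infinite (by positivity)).exists_subset_card_eq _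
  have hDc : Continuous D := (hr.continuous_fderiv one_ne_zero).sub continuous_const
  have hint : ∀ t : ℝ, MeasureTheory.IntegrableOn
      (fun x => (ContinuousLinearMap.id ℝ E + t • D x).det) (ball (0:E) 1) μ := by
    intro t
    have hc : Continuous (fun x => (ContinuousLinearMap.id ℝ E + t • D x).det) :=
      ContinuousLinearMap.continuous_det.comp (by fun_prop)
    exact (hc.continuousOn.integrableOn_compact (isCompact_closedBall (0:E) 1)).mono_set
      ball_subset_closedBall
  have hone : ∫ x in ball (0:E) 1, (ContinuousLinearMap.id ℝ E + (1:ℝ) • D x).det ∂μ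
      = μ.real (ball (0:E) 1) := by
    have : ∀ x, (ContinuousLinearMap.id ℝ E + (1:ℝ) • D x).det = _ := fun x =>
      det_id_add_interp s (by omega) (D x) 1
    simp only [this]
    rw [MeasureTheory.integral_finsetSum _ (fun t _ => (hint t).const_mul _)]
    simp only [MeasureTheory.integral_const_mul]
    have h3 : ∀ t ∈ s, ∫ x in ball (0:E) 1, (ContinuousLinearMap.id ℝ E + t • D x).det ∂μ
        = μ.real (ball (0:E) 1) := by
      intro t ht
      have := hs ht
      refine hsmall t this.1 ?_
      have h4 := this.2
      have hLp : (0:ℝ) ≤ L := L.2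
      rw [le_div_iff₀ (by positivity)] at h4
      have := this.1
      nlinarith
    rw [Finset.sum_congr rfl (fun t ht => by rw [h3 t ht])]
    rw [← Finset.sum_mul, ← Polynomial.eval_finsetSum, Lagrange.sum_basis (Set.injOn_id _)
      (Finset.card_pos.1 (by omega))]
    simp
  have hzero : ∀ x, (ContinuousLinearMap.id ℝ E + (1:ℝ) • D x).det = 0 := by
    intro x
    have : ContinuousLinearMap.id ℝ E + (1:ℝ) • D x = fderiv ℝ r x := by simp [D]
    rw [this]
    by_contra hne
    have hu : IsUnit (LinearMap.det (fderiv ℝ r x : E →ₗ[ℝ] E)) := isUnit_iff_ne_zero.2 hne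
    rw [← LinearMap.isUnit_iff_isUnit_det, Module.End.isUnit_iff] at hu
    obtain ⟨v, hv⟩ := hu.2 (r x)
    have hv' : fderiv ℝ r x v = r x := hv
    have hd := (hrd x).hasFDerivAt.norm_sq
    have hcst : (fun y => ‖r y‖ ^ 2) = fun _ => (1:ℝ) := by ext y; simp [h1]
    rw [hcst] at hd
    have := hd.unique (hasFDerivAt_const (1:ℝ) x)
    have := congrArg (fun A => A v) this
    simp [hv', h1] at this
  simp only [hzero, MeasureTheory.integral_zero] at hone
  have : 0 < μ.real (ball (0:E) 1) := by
    rw [MeasureTheory.measureReal_def]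
    exact ENNReal.toReal_pos (isOpen_ball.measure_pos μ ⟨0, by simp⟩).ne' MeasureTheory.measure_ball_lt_top.ne
  linarith

theorem exists_zero_of_inner_pos {E : Type*} [NormedAddCommGroup E] [InnerProductSpace ℝ E]
    [FiniteDimensional ℝ E] (h : E → E) (hc : ContinuousOn h (closedBall 0 1))
    (hp : ∀ b, ‖b‖ = 1 → 0 < inner ℝ (h b) b) : ∃ b ∈ closedBall (0:E) 1, h b = 0 := by
  by_contra hcon
  push Not at hcon
  let ρ : E → E := fun x => (max 1 ‖x‖)⁻¹ • x
  let s : E → ℝ := fun x => max 0 (min 1 (‖x‖ - 1))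
  have hm : ∀ x : E, 0 < max 1 ‖x‖ := fun x => lt_max_of_lt_left one_pos
  have hρc : Continuous ρ := by
    refine Continuous.smul (Continuous.inv₀ (by fun_prop) fun x => (hm x).ne') continuous_id
  have hρB : ∀ x, ρ x ∈ closedBall (0:E) 1 := by
    intro x
    simp only [ρ, mem_closedBall_zero_iff, norm_smul, norm_inv, Real.norm_of_nonneg (hm x).le]
    rw [inv_mul_le_iff₀ (hm x), mul_one]
    exact le_max_right _ _
  have hsc : Continuous s := by fun_prop
  let H : E → E := fun x => (1 - s x) • h (ρ x) + s x • x
  have hHc : Continuous H := by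
    have : Continuous (fun x => h (ρ x)) := hc.comp_continuous hρc hρB
    exact ((continuous_const.sub hsc).smul this).add (hsc.smul continuous_id)
  have hH0 : ∀ x, H x ≠ 0 := by
    intro x hx
    by_cases h1 : ‖x‖ ≤ 1
    · have e1 : s x = 0 := by simp only [s]; rw [max_eq_left]; exact (min_le_right _ _).trans (by linarith)
      have e2 : ρ x = x := by simp [ρ, max_eq_left h1]
      simp only [H, e1, e2, sub_zero, one_smul, zero_smul, add_zero] at hx
      exact hcon x (by simpa using h1) hx
    · push Not at h1
      have e0 : max 1 ‖x‖ = ‖x‖ := max_eq_right h1.le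
      have e1 : ‖ρ x‖ = 1 := by
        simp only [ρ, e0, norm_smul, norm_inv, norm_norm]
        exact inv_mul_cancel₀ (by linarith)
      have e2 : 0 < s x := lt_max_of_lt_right (lt_min one_pos (by linarith))
      have e3 : s x ≤ 1 := max_le zero_le_one (min_le_left _ _)
      have e4 := hp _ e1
      have e5 : inner ℝ x (ρ x) = ‖x‖ := by
        simp only [ρ, e0, inner_smul_right, real_inner_self_eq_norm_sq]
        field_simp
      have : inner ℝ (H x) (ρ x) = (1 - s x) * inner ℝ (h (ρ x)) (ρ x) + s x * ‖x‖ := by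
        simp only [H, inner_add_left, inner_smul_left, e5]; simp
      rw [hx, inner_zero_left] at this
      have : 0 < s x * ‖x‖ := mul_pos e2 (by linarith)
      nlinarith [mul_nonneg (sub_nonneg.2 e3) e4.le]
  have hHid : ∀ x, 2 ≤ ‖x‖ → H x = x := by
    intro x hx
    have e1 : s x = 1 := by
      simp only [s]; rw [min_eq_left (by linarith)]; simp
    simp [H, e1]
  obtain ⟨g, hg, hgε, hgS, -⟩ := hHc.exists_contDiff_approx_and_eqOn (1 : ℕ∞) hHc.norm
    (fun x => norm_pos_iff.2 (hH0 x)) (S := {x | 3 ≤ ‖x‖}) (U := {x | 2 < ‖x‖})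
    (isClosed_le continuous_const continuous_norm)
    ((isOpen_lt continuous_const continuous_norm).mem_nhdsSet.2
      (fun x hx => by simp only [mem_ofPred_eq] at *; linarith))
    ((contDiff_id.contDiffOn).congr (fun x hx => hHid x (le_of_lt hx)))
  have hg0 : ∀ x, g x ≠ 0 := by
    intro x hx
    have := hgε x
    rw [hx, dist_eq_norm, zero_sub, norm_neg] at this
    exact lt_irrefl _ this
  have hg3 : ContDiff ℝ 1 (fun x : E => g ((3:ℝ) • x)) := by
    have hg' : ContDiff ℝ 1 g := by exact_mod_cast hg
    exact hg'.comp (contDiff_const_smul (3:ℝ))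
  refine no_C1_retraction (fun x => ‖g ((3:ℝ) • x)‖⁻¹ • g ((3:ℝ) • x)) ?_ ?_ ?_
  · exact ((hg3.norm ℝ fun x => hg0 _).inv (fun x => (norm_pos_iff.2 (hg0 _)).ne')).smul hg3
  · intro x
    rw [norm_smul, norm_inv, norm_norm]
    exact inv_mul_cancel₀ (norm_pos_iff.2 (hg0 _)).ne'
  · intro x hx
    have h3 : ‖(3:ℝ) • x‖ = 3 := by rw [norm_smul, hx]; simp
    have : g ((3:ℝ) • x) = (3:ℝ) • x := by
      rw [hgS (show _ ∈ {x : E | 3 ≤ ‖x‖} from h3.ge), hHid]; rw [h3]; norm_num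
    simp only [this, h3]
    rw [smul_smul]; norm_num

theorem invariance_unit {E : Type*} [NormedAddCommGroup E] [InnerProductSpace ℝ E]
    [FiniteDimensional ℝ E] (f : E → E) (hf : ContinuousOn f (closedBall 0 1))
    (hinj : InjOn f (closedBall 0 1)) : f '' closedBall 0 1 ∈ nhds (f 0) := by
  let _ : MeasurableSpace E := borel E
  have : BorelSpace E := ⟨rfl⟩
  let μ : MeasureTheory.Measure E := MeasureTheory.volume
  by_contra hcon
  let e : closedBall (0:E) 1 → E := fun x => f x
  have hec : Continuous e := continuousOn_iff_continuous_domRestrict.1 hf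
  have hemb : Topology.IsClosedEmbedding e := by
    have : CompactSpace (closedBall (0:E) 1) := isCompact_iff_compactSpace.1 (isCompact_closedBall _ _)
    exact hec.isClosedEmbedding (fun a b hab => Subtype.ext (hinj a.2 b.2 hab))
  obtain ⟨G, hG⟩ := ContinuousMap.exists_extension' hemb
    (⟨Subtype.val, continuous_subtype_val⟩ : C(closedBall (0:E) 1, E))
  have hGf : ∀ x ∈ closedBall (0:E) 1, G (f x) = x := fun x hx => congrFun hG ⟨x, hx⟩
  have h0B : (0:E) ∈ closedBall (0:E) 1 := by simp
  have hG0 : G (f 0) = 0 := hGf 0 h0B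
  obtain ⟨ε', hε', hGε'⟩ := Metric.continuousAt_iff.1 (G.continuous.continuousAt (x := f 0)) (1/10)
    (by norm_num)
  let ε := ε' / 2
  have hε : 0 < ε := by positivity
  have hGε : ∀ y, ‖y - f 0‖ < 2 * ε → ‖G y‖ < 1/10 := by
    intro y hy
    have := hGε' (x := y) (by rw [dist_eq_norm]; simp only [ε] at hy; linarith)
    simpa [hG0, dist_eq_norm] using this
  obtain ⟨c, hcε, hc⟩ : ∃ c ∈ ball (f 0) ε, c ∉ f '' closedBall 0 1 := by
    by_contra h
    push Not at h
    exact hcon (Filter.mem_of_superset (ball_mem_nhds _ hε) h)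
  rw [mem_ball, dist_eq_norm] at hcε
  have hK : IsCompact (f '' closedBall 0 1) := (isCompact_closedBall _ _).image_of_continuousOn hf
  have hSg : IsCompact (f '' closedBall 0 1 ∩ {y | ε ≤ ‖y - c‖}) :=
    hK.inter_right (isClosed_le continuous_const (by fun_prop))
  obtain ⟨δ₀, hδ₀, hGδ₀⟩ := hSg.exists_forall_le' (f := fun y => ‖G y‖) (a := 0)
    G.continuous.norm.continuousOn (by
      rintro _ ⟨⟨x, hx, rfl⟩, hy⟩
      rw [hGf x hx, norm_pos_iff]
      rintro rfl
      rw [mem_ofPred_eq, norm_sub_rev] at hy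
      linarith)
  let δ := min δ₀ (1/10)
  have hδ : 0 < δ := lt_min hδ₀ (by norm_num)
  have hδ1 : δ ≤ 1/10 := min_le_right _ _
  obtain ⟨P, hP, hPG, -⟩ := G.continuous.exists_contDiff_approx (1 : ℕ∞) (ε := fun _ => δ/4)
    continuous_const (fun _ => by positivity)
  have hP1 : ContDiff ℝ 1 P := by exact_mod_cast hP
  have hnull : μ (P '' sphere c ε) = 0 :=
    MeasureTheory.addHaar_image_eq_zero_of_differentiableOn_of_addHaar_eq_zero μ
      (hP1.differentiable one_ne_zero).differentiableOn
      (MeasureTheory.Measure.addHaar_sphere_of_ne_zero μ c hε.ne')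
  obtain ⟨v, hvδ, hv⟩ : ∃ v ∈ ball (0:E) (δ/4), v ∉ P '' sphere c ε := by
    by_contra h
    push Not at h
    have := MeasureTheory.measure_mono_null (show ball (0:E) (δ/4) ⊆ P '' sphere c ε from h) hnull
    exact (isOpen_ball.measure_pos μ ⟨0, by simp; positivity⟩).ne' this
  rw [mem_ball_zero_iff] at hvδ
  have hQ : ∀ y, ‖P y - v - G y‖ < δ / 2 := by
    intro y
    have := hPG y
    rw [dist_eq_norm] at this
    calc ‖P y - v - G y‖ = ‖(P y - G y) - v‖ := by congr 1; abel
      _ ≤ ‖P y - G y‖ + ‖v‖ := norm_sub_le _ _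
      _ < δ/2 := by linarith
  let Φ : E → E := fun y => c + max (ε / ‖y - c‖) 1 • (y - c)
  have hne : ∀ x ∈ closedBall (0:E) 1, f x - c ≠ 0 := by
    intro x hx h
    exact hc ⟨x, hx, sub_eq_zero.1 h⟩
  have hΦc : ContinuousOn (fun x => Φ (f x)) (closedBall 0 1) := by
    refine continuousOn_const.add (ContinuousOn.smul (ContinuousOn.sup (ContinuousOn.div continuousOn_const
      (hf.sub continuousOn_const).norm ?_) continuousOn_const) (hf.sub continuousOn_const))
    intro x hx
    exact (norm_pos_iff.2 (hne x hx)).ne'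
  have hcase : ∀ x ∈ closedBall (0:E) 1, P (Φ (f x)) - v ≠ 0 ∧ ‖P (Φ (f x)) - v - x‖ < 1 := by
    intro x hx
    have hpos := norm_pos_iff.2 (hne x hx)
    by_cases hy : ε ≤ ‖f x - c‖
    · have hid : Φ (f x) = f x := by
        simp only [Φ]
        rw [max_eq_right ((div_le_one hpos).2 hy)]; simp
      rw [hid]
      have h1 := hQ (f x)
      have h2 : δ ≤ ‖G (f x)‖ := (min_le_left _ _).trans (hGδ₀ _ ⟨⟨x, hx, rfl⟩, hy⟩)
      constructor
      · intro h
        rw [h, zero_sub, norm_neg] at h1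
        linarith
      · rw [hGf x hx] at h1; linarith
    · push Not at hy
      have hΦn : ‖Φ (f x) - c‖ = ε := by
        simp only [Φ, add_sub_cancel_left]
        rw [max_eq_left ((one_le_div hpos).2 hy.le), norm_smul, norm_div, norm_norm,
          Real.norm_of_nonneg hε.le]
        field_simp
      constructor
      · intro h
        exact hv ⟨Φ (f x), by rw [mem_sphere, dist_eq_norm, hΦn], sub_eq_zero.1 h⟩
      · have h1 := hQ (Φ (f x))
        have h2 : ‖G (Φ (f x))‖ < 1/10 := hGε _ (by
          calc ‖Φ (f x) - f 0‖ = ‖(Φ (f x) - c) + (c - f 0)‖ := by congr 1; abel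
            _ ≤ ‖Φ (f x) - c‖ + ‖c - f 0‖ := norm_add_le _ _
            _ < 2 * ε := by linarith)
        have h3 : ‖G (f x)‖ < 1/10 := hGε _ (by
          calc ‖f x - f 0‖ = ‖(f x - c) + (c - f 0)‖ := by congr 1; abel
            _ ≤ ‖f x - c‖ + ‖c - f 0‖ := norm_add_le _ _
            _ < 2 * ε := by linarith)
        rw [hGf x hx] at h3
        calc ‖P (Φ (f x)) - v - x‖ = ‖(P (Φ (f x)) - v - G (Φ (f x))) + (G (Φ (f x)) - x)‖ := by
              congr 1; abel
          _ ≤ ‖P (Φ (f x)) - v - G (Φ (f x))‖ + ‖G (Φ (f x)) - x‖ := norm_add_le _ _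
          _ ≤ ‖P (Φ (f x)) - v - G (Φ (f x))‖ + (‖G (Φ (f x))‖ + ‖x‖) := by
              gcongr; exact norm_sub_le _ _
          _ < 1 := by linarith
  obtain ⟨b, hb, hb0⟩ := exists_zero_of_inner_pos (fun x => P (Φ (f x)) - v)
    ((hP1.continuous.comp_continuousOn hΦc).sub continuousOn_const) (by
      intro b hb
      have := (hcase b (by simp [hb])).2
      have h1 : inner ℝ (P (Φ (f b)) - v) b = inner ℝ (P (Φ (f b)) - v - b) b + 1 := by
        rw [inner_sub_left _ b, real_inner_self_eq_norm_sq, hb]; ring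
      have h2 := abs_real_inner_le_norm (P (Φ (f b)) - v - b) b
      rw [hb, mul_one] at h2
      have := (abs_le.1 h2).1
      rw [h1]; linarith)
  exact (hcase b hb).1 hb0

theorem invariance_of_domain_ball {E F : Type*} [NormedAddCommGroup E] [InnerProductSpace ℝ E]
    [FiniteDimensional ℝ E] [NormedAddCommGroup F] [InnerProductSpace ℝ F] [FiniteDimensional ℝ F]
    (hdim : Module.finrank ℝ E = Module.finrank ℝ F) (f : E → F) (a : E) (ρ : ℝ) (hρ : 0 < ρ)
    (hf : ContinuousOn f (closedBall a ρ))
    (hinj : InjOn f (closedBall a ρ)) : f '' closedBall a ρ ∈ nhds (f a) := by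
  let L : F ≃L[ℝ] E := ContinuousLinearEquiv.ofFinrankEq hdim.symm
  let T : E → E := fun x => a + ρ • x
  have hT : MapsTo T (closedBall 0 1) (closedBall a ρ) := by
    intro x hx
    rw [mem_closedBall_zero_iff] at hx
    rw [mem_closedBall, dist_eq_norm, add_sub_cancel_left, norm_smul, Real.norm_of_nonneg hρ.le]
    nlinarith
  have hTc : Continuous T := by fun_prop
  have key := invariance_unit (fun x => L (f (T x)))
    (L.continuous.comp_continuousOn (hf.comp hTc.continuousOn hT)) (by
      intro x hx y hy hxy
      have := hinj (hT hx) (hT hy) (L.injective hxy)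
      simpa [T, hρ.ne'] using this)
  have hT0 : T 0 = a := by simp [T]
  rw [hT0] at key
  have := L.continuous.continuousAt.preimage_mem_nhds key
  refine Filter.mem_of_superset this ?_
  rintro y ⟨x, hx, hxy⟩
  exact ⟨T x, hT hx, L.injective hxy⟩

end BrouwerPart

section PushPart

open Topology

/-- Points that some half-space chart sends to the open half-space. -/
def chartInterior (m : ℕ) [NeZero m] (M : Type*) [TopologicalSpace M] : Set M :=
  {z | ∃ e : OpenPartialHomeomorph M (EuclideanHalfSpace m), z ∈ e.source ∧ 0 < (e z).1 0}

lemma push_single {m : ℕ} [NeZero m] {M : Type*} [TopologicalSpace M] [T2Space M]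
    [ChartedSpace (EuclideanHalfSpace m) M] (N : Set M) (hN : IsOpen N) (y : M) (hy : y ∈ N) :
    ∃ O ∈ 𝓝 y, ∃ φ : M → M, Continuous φ ∧ (∀ z, z ∉ N → φ z = z) ∧ (∀ z ∈ N, φ z ∈ N) ∧
      (∀ z, φ z = z ∨ φ z ∈ chartInterior m M) ∧ ∀ z ∈ O, φ z ∈ chartInterior m M := by
  classical
  let e := chartAt (EuclideanHalfSpace m) y
  have hye : y ∈ e.source := mem_chart_source _ y
  have hval : IsEmbedding (Subtype.val : EuclideanHalfSpace m → EuclideanSpace ℝ (Fin m)) :=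
    IsEmbedding.subtypeVal
  let d : EuclideanHalfSpace m → ℝ := fun w => dist w.1 (e y).1
  have hdc : Continuous d := hval.continuous.dist continuous_const
  obtain ⟨ρ, hρ, hT⟩ : ∃ ρ > 0, ∀ w, d w ≤ 3 * ρ → w ∈ e.target ∧ e.symm w ∈ N := by
    have h1 : e.target ∩ e.symm ⁻¹' N ∈ 𝓝 (e y) := by
      refine (e.isOpen_inter_preimage_symm hN).mem_nhds ⟨e.map_source hye, ?_⟩
      simpa [e.left_inv hye] using hy
    rw [hval.isInducing.nhds_eq_comap] at h1
    obtain ⟨V, hV, hVs⟩ := Filter.mem_comap.1 h1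
    obtain ⟨δ, hδ, hb⟩ := Metric.mem_nhds_iff.1 hV
    refine ⟨δ / 4, by positivity, fun w hw => hVs (hb ?_)⟩
    rw [mem_ball]
    exact lt_of_le_of_lt hw (by linarith)
  let η : EuclideanHalfSpace m → ℝ := fun w => max 0 (ρ - d w)
  have hη0 : ∀ w, 0 ≤ η w := fun w => le_max_left _ _
  have hηρ : ∀ w, η w ≤ ρ := fun w => max_le hρ.le (by
    have : 0 ≤ d w := dist_nonneg
    linarith)
  have hηc : Continuous η := by fun_prop
  let P : EuclideanHalfSpace m → EuclideanHalfSpace m := fun w =>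
    ⟨w.1 + η w • EuclideanSpace.single 0 1, by
      have := w.2
      have := hη0 w
      simp
      linarith⟩
  have hPc : Continuous P :=
    Continuous.subtype_mk (hval.continuous.add (hηc.smul continuous_const)) _
  have hP0 : ∀ w, (P w).1 0 = w.1 0 + η w := fun w => by simp [P]
  have hPd : ∀ w, d (P w) ≤ d w + ρ := by
    intro w
    have h1 : dist (P w).1 w.1 = η w := by
      simp [P, dist_eq_norm, norm_smul, abs_of_nonneg (hη0 w)]
    have := dist_triangle (P w).1 w.1 (e y).1
    have := hηρ w
    simp only [d]
    linarith
  have hPid : ∀ w, ρ ≤ d w → P w = w := by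
    intro w hw
    have : η w = 0 := max_eq_left (by linarith)
    apply Subtype.ext
    simp [P, this]
  let A : Set M := {z | z ∈ e.source ∧ d (e z) ≤ ρ}
  have hA : IsClosed A := by
    have hcl : IsClosedEmbedding (Subtype.val : EuclideanHalfSpace m → EuclideanSpace ℝ (Fin m)) := by
      refine IsClosed.isClosedEmbedding_subtypeVal ?_
      have h0 : IsClosed {x : EuclideanSpace ℝ (Fin m) | 0 ≤ x 0} :=
        isClosed_le continuous_const (by fun_prop)
      exact h0
    have hcomp : IsCompact {w : EuclideanHalfSpace m | d w ≤ ρ} :=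
      hcl.isCompact_preimage (isCompact_closedBall (e y).1 ρ)
    have : A = e.symm '' {w | d w ≤ ρ} := by
      ext z
      constructor
      · rintro ⟨h1, h2⟩
        exact ⟨e z, h2, e.left_inv h1⟩
      · rintro ⟨w, hw, rfl⟩
        have hw' : d w ≤ ρ := hw
        have ht := (hT w (by linarith)).1
        exact ⟨e.map_target ht, by rw [e.right_inv ht]; exact hw⟩
    rw [this]
    refine (hcomp.image_of_continuousOn (e.continuousOn_symm.mono ?_)).isClosed
    intro w hw
    have hw' : d w ≤ ρ := hw
    exact (hT w (by linarith)).1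
  have hAN : A ⊆ N := by
    rintro z ⟨h1, h2⟩
    have := (hT (e z) (by linarith)).2
    rwa [e.left_inv h1] at this
  let φ : M → M := fun z => if z ∈ A then e.symm (P (e z)) else z
  have hPt : ∀ z ∈ A, P (e z) ∈ e.target ∧ e.symm (P (e z)) ∈ N := by
    intro z hz
    exact hT _ ((hPd _).trans (by linarith [hz.2]))
  have hφV : ∀ z ∈ e.source, φ z = e.symm (P (e z)) := by
    intro z hz
    by_cases hzA : z ∈ A
    · simp [φ, hzA]
    · have : ρ < d (e z) := by
        by_contra h
        exact hzA ⟨hz, not_lt.1 h⟩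
      simp [φ, hzA, hPid _ this.le, e.left_inv hz]
  have hint : ∀ z ∈ e.source, d (e z) < ρ → φ z ∈ chartInterior m M := by
    intro z hz hd
    have hzA : z ∈ A := ⟨hz, hd.le⟩
    have ht := (hPt z hzA).1
    rw [hφV z hz]
    refine ⟨e, e.map_target ht, ?_⟩
    rw [e.right_inv ht, hP0]
    have h1 : 0 < η (e z) := lt_max_of_lt_right (by linarith)
    have := (e z).2
    linarith
  refine ⟨e.source ∩ e ⁻¹' {w | d w < ρ}, ?_, φ, ?_, ?_, ?_, ?_, ?_⟩
  · refine (e.isOpen_inter_preimage (isOpen_lt hdc continuous_const)).mem_nhds ⟨hye, ?_⟩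
    simpa [d] using hρ
  · rw [continuous_iff_continuousAt]
    intro z
    by_cases hz : z ∈ A
    · have h1 : φ =ᶠ[𝓝 z] fun z => e.symm (P (e z)) := by
        filter_upwards [e.open_source.mem_nhds hz.1] with z' hz'
        exact hφV z' hz'
      refine ContinuousAt.congr ?_ h1.symm
      have h2 : ContinuousAt (fun z => P (e z)) z :=
        ContinuousAt.comp (g := P) hPc.continuousAt (e.continuousAt hz.1)
      exact ContinuousAt.comp (g := e.symm) (f := fun z => P (e z))
        (e.continuousAt_symm (hPt z hz).1) h2
    · have h1 : φ =ᶠ[𝓝 z] id := by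
        filter_upwards [hA.isOpen_compl.mem_nhds hz] with z' hz'
        exact if_neg hz'
      exact continuousAt_id.congr h1.symm
  · intro z hz
    exact if_neg fun h => hz (hAN h)
  · intro z hz
    by_cases hzA : z ∈ A
    · simp only [φ, hzA, if_true]; exact (hPt z hzA).2
    · simpa [φ, hzA] using hz
  · intro z
    by_cases hzA : z ∈ A
    · rcases lt_or_eq_of_le hzA.2 with h | h
      · exact Or.inr (hint z hzA.1 h)
      · left
        rw [hφV z hzA.1, hPid _ h.ge, e.left_inv hzA.1]
    · left; exact if_neg hzA
  · rintro z ⟨hz, hd⟩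
    exact hint z hz hd

lemma push_off {m : ℕ} [NeZero m] {M : Type*} [TopologicalSpace M] [T2Space M]
    [ChartedSpace (EuclideanHalfSpace m) M] (N : Set M) (hN : IsOpen N) (F : Set M)
    (hF : IsCompact F) (hFN : F ⊆ N) :
    ∃ φ : M → M, Continuous φ ∧ (∀ z, z ∉ N → φ z = z) ∧ (∀ z ∈ N, φ z ∈ N) ∧
      (∀ z, φ z = z ∨ φ z ∈ chartInterior m M) ∧ ∀ z ∈ F, φ z ∈ chartInterior m M := by
  refine hF.induction_on (p := fun A => ∃ φ : M → M, Continuous φ ∧ (∀ z, z ∉ N → φ z = z) ∧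
      (∀ z ∈ N, φ z ∈ N) ∧
      (∀ z, φ z = z ∨ φ z ∈ chartInterior m M) ∧ ∀ z ∈ A, φ z ∈ chartInterior m M) ?_ ?_ ?_ ?_
  · exact ⟨id, continuous_id, fun _ _ => rfl, fun _ h => h, fun _ => Or.inl rfl, fun z hz => hz.elim⟩
  · rintro s t hst ⟨φ, h1, h2, h3, h4, h5⟩
    exact ⟨φ, h1, h2, h3, h4, fun z hz => h5 z (hst hz)⟩
  · rintro s t ⟨φ, h1, h2, h3, h4, h5⟩ ⟨ψ, k1, k2, k3, k4, k5⟩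
    have key : ∀ z, φ z ∈ chartInterior m M → ψ (φ z) ∈ chartInterior m M := by
      intro z hz
      rcases k4 (φ z) with h | h
      · rwa [h]
      · exact h
    refine ⟨ψ ∘ φ, k1.comp h1, fun z hz => ?_, fun z hz => k3 _ (h3 z hz), fun z => ?_, ?_⟩
    · simp only [Function.comp, h2 z hz, k2 z hz]
    · rcases h4 z with h | h
      · simp only [Function.comp, h]; exact k4 z
      · exact Or.inr (key z h)
    · rintro z (hz | hz)
      · exact key z (h5 z hz)
      · rcases h4 z with h | h
        · simp only [Function.comp, h]; exact k5 z hz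
        · exact key z h
  · intro y hy
    obtain ⟨O, hO, φ, hφ⟩ := push_single (m := m) N hN y (hFN hy)
    exact ⟨O, mem_nhdsWithin_of_mem_nhds hO, φ, hφ⟩

end PushPart

section BoundaryPart

open Topology

lemma interior_of_chartInterior {n : ℕ} [NeZero (n - 1)] (K S : Set (EuclideanSpace ℝ (Fin n)))
    (hconv : Convex ℝ K) (h0 : (0 : EuclideanSpace ℝ (Fin n)) ∈ interior K)
    (hS : S ⊆ frontier K) (Q : S) (hQ : Q ∈ chartInterior (n - 1) S) :
    ∀ᶠ y in 𝓝 (Q : EuclideanSpace ℝ (Fin n)), y ∈ frontier K → y ∈ S := by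
  obtain ⟨e, hQe, hpos⟩ := hQ
  have hKn : K ∈ 𝓝 (0 : EuclideanSpace ℝ (Fin n)) := mem_interior_iff_mem_nhds.1 h0
  let q : EuclideanSpace ℝ (Fin n) := Q
  have hg : ∀ y ∈ frontier K, gauge K y = 1 := fun y hy =>
    (gauge_eq_one_iff_mem_frontier hconv hKn).2 hy
  have hq0 : q ≠ 0 := by
    intro h
    have h1 := hg q (hS Q.2)
    rw [h, gauge_zero] at h1
    exact zero_ne_one h1
  have hqq : 0 < inner ℝ q q := by
    rw [real_inner_self_eq_norm_sq]; have := norm_pos_iff.2 hq0; positivity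
  let V : Submodule ℝ (EuclideanSpace ℝ (Fin n)) := (Submodule.span ℝ {q})ᗮ
  have hdim : Module.finrank ℝ (EuclideanSpace ℝ (Fin (n - 1))) = Module.finrank ℝ V := by
    have h1 := Submodule.finrank_add_finrank_orthogonal (Submodule.span ℝ {q})
    rw [finrank_span_singleton hq0, finrank_euclideanSpace_fin] at h1
    rw [finrank_euclideanSpace_fin]
    change n - 1 = Module.finrank ℝ (Submodule.span ℝ {q})ᗮ
    omega
  let τ : EuclideanSpace ℝ (Fin n) → V := fun y => (inner ℝ q y)⁻¹ • V.orthogonalProjection y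
  have hτc : ∀ y, 0 < inner ℝ q y → ContinuousAt τ y := by
    intro y hy
    refine ContinuousAt.smul (ContinuousAt.inv₀ (by fun_prop) hy.ne') (by fun_prop)
  have hτinj : ∀ y ∈ frontier K, ∀ y' ∈ frontier K, 0 < inner ℝ q y → 0 < inner ℝ q y' →
      τ y = τ y' → y = y' := by
    intro y hy y' hy' h1 h2 h
    let c := inner ℝ q y' / inner ℝ q y
    have hc : 0 < c := div_pos h2 h1
    have hdiff : y' - c • y ∈ Vᗮ := by
      rw [← Submodule.orthogonalProjection_eq_zero_iff]
      rw [map_sub, map_smul]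
      have h3 : V.orthogonalProjection y' = inner ℝ q y' • τ y' := by
        simp only [τ]; rw [smul_smul, mul_inv_cancel₀ h2.ne', one_smul]
      rw [h3, ← h]
      simp only [τ, c]
      rw [smul_smul, ← div_eq_mul_inv, sub_self]
    rw [Submodule.orthogonal_orthogonal, Submodule.mem_span_singleton] at hdiff
    obtain ⟨a, ha⟩ := hdiff
    have h4 : a * inner ℝ q q = 0 := by
      rw [← inner_smul_right, ha, inner_sub_right, inner_smul_right]
      simp only [c]
      field_simp; simp
    have ha0 : a = 0 := by
      rcases mul_eq_zero.1 h4 with h5 | h5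
      · exact h5
      · exact absurd h5 hqq.ne'
    rw [ha0, zero_smul] at ha
    have h5 : y' = c • y := (sub_eq_zero.1 ha.symm)
    have h6 := hg y' hy'
    rw [h5, gauge_smul_of_nonneg hc.le, hg y hy, smul_eq_mul, mul_one] at h6
    rw [h5, h6, one_smul]
  let ψ : EuclideanSpace ℝ (Fin (n - 1)) → EuclideanHalfSpace (n - 1) := fun v =>
    ⟨v + max 0 (-(v 0)) • EuclideanSpace.single 0 1, by
      have := le_max_right 0 (-(v 0))
      simp; linarith⟩
  have hψc : Continuous ψ := Continuous.subtype_mk (by fun_prop) _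
  have hψid : ∀ v, 0 ≤ v 0 → (ψ v).1 = v := by
    intro v hv
    have : max 0 (-(v 0)) = 0 := max_eq_left (by linarith)
    simp only [ψ, this]; simp
  let a : EuclideanSpace ℝ (Fin (n - 1)) := (e Q).1
  have hψa : ψ a = e Q := Subtype.ext (hψid a (e Q).2)
  obtain ⟨ρ, hρ, hball⟩ : ∃ ρ > 0, ∀ v ∈ closedBall a ρ, 0 ≤ v 0 ∧ ψ v ∈ e.target ∧
      0 < inner ℝ q ((e.symm (ψ v) : S) : EuclideanSpace ℝ (Fin n)) := by
    have hN : IsOpen {z : S | 0 < inner ℝ q (z : EuclideanSpace ℝ (Fin n))} :=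
      isOpen_lt continuous_const (by fun_prop)
    have h1 : {v : EuclideanSpace ℝ (Fin (n - 1)) | 0 < v 0} ∩ ψ ⁻¹' (e.target ∩ e.symm ⁻¹'
        {z : S | 0 < inner ℝ q (z : EuclideanSpace ℝ (Fin n))}) ∈ 𝓝 a := by
      refine IsOpen.mem_nhds ((isOpen_lt continuous_const (by fun_prop)).inter
        ((e.isOpen_inter_preimage_symm hN).preimage hψc)) ⟨hpos, ?_⟩
      rw [mem_preimage, hψa]
      refine ⟨e.map_source hQe, ?_⟩
      rw [mem_preimage, e.left_inv hQe]
      exact hqq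
    obtain ⟨ρ, hρ, h2⟩ := Metric.nhds_basis_closedBall.mem_iff.1 h1
    refine ⟨ρ, hρ, fun v hv => ?_⟩
    obtain ⟨h3, h4, h5⟩ := h2 hv
    exact ⟨le_of_lt h3, h4, h5⟩
  let f : EuclideanSpace ℝ (Fin (n - 1)) → V := fun v => τ (e.symm (ψ v) : S)
  have hfc : ContinuousOn f (closedBall a ρ) := by
    intro v hv
    obtain ⟨h1, h2, h3⟩ := hball v hv
    refine ContinuousAt.continuousWithinAt ?_
    have h4 : ContinuousAt (fun v => ((e.symm (ψ v) : S) : EuclideanSpace ℝ (Fin n))) v := by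
      have h5 : ContinuousAt (fun v => e.symm (ψ v)) v :=
        ContinuousAt.comp (g := e.symm) (f := ψ) (e.continuousAt_symm h2) hψc.continuousAt
      exact ContinuousAt.comp (g := Subtype.val) continuous_subtype_val.continuousAt h5
    exact ContinuousAt.comp (g := τ) (f := fun v => ((e.symm (ψ v) : S) : EuclideanSpace ℝ (Fin n)))
      (hτc _ h3) h4
  have hfinj : InjOn f (closedBall a ρ) := by
    intro v hv w hw hvw
    obtain ⟨h1, h2, h3⟩ := hball v hv
    obtain ⟨k1, k2, k3⟩ := hball w hw
    have h4 := hτinj _ (hS (e.symm (ψ v)).2) _ (hS (e.symm (ψ w)).2) h3 k3 hvw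
    have h5 := e.symm.injOn h2 k2 (Subtype.ext h4)
    rw [← hψid v h1, ← hψid w k1, h5]
  have key := invariance_of_domain_ball hdim f a ρ hρ hfc hfinj
  have hfa : f a = τ q := by simp only [f, hψa, e.left_inv hQe, q]
  rw [hfa] at key
  have e1 := (hτc q hqq).preimage_mem_nhds key
  have e2 : {y : EuclideanSpace ℝ (Fin n) | 0 < inner ℝ q y} ∈ 𝓝 q :=
    (isOpen_lt continuous_const (by fun_prop)).mem_nhds hqq
  filter_upwards [e1, e2] with y hy hy2 hyK
  obtain ⟨v, hv, hvy⟩ := hy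
  have := hτinj _ (hS (e.symm (ψ v)).2) y hyK (hball v hv).2.2 hy2 hvy
  rw [← this]
  exact (e.symm (ψ v)).2

end BoundaryPart

section CorePart

open Topology Filter

lemma exists_cyl_gauge {n : ℕ} (K : Set (EuclideanSpace ℝ (Fin n)))
    (x : EuclideanSpace ℝ (Fin n)) (hconv : Convex ℝ K) (h0 : 0 ∈ interior K) :
    ∃ p : EuclideanSpace ℝ (Fin n) → ℝ, Continuous p ∧
      (∀ y, p y < 1 ↔ ∃ t : ℝ, y + t • x ∈ interior K) ∧
      (∀ (c : ℝ) y, 0 ≤ c → p (c • y) = c * p y) ∧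
      (∀ y (t : ℝ), p (y + t • x) = p y) ∧ (∀ y ∈ K, p y ≤ 1) ∧ (∀ y, 0 ≤ p y) := by
  let C : Set (EuclideanSpace ℝ (Fin n)) := {y | ∃ t : ℝ, y + t • x ∈ interior K}
  have hKC : interior K ⊆ C := fun y hy => ⟨0, by simpa using hy⟩
  have hC : C = ⋃ t : ℝ, (fun y => y + t • x) ⁻¹' interior K := by
    ext y; simp [C]
  have hCo : IsOpen C := by
    rw [hC]
    exact isOpen_iUnion fun t => isOpen_interior.preimage (by fun_prop)
  have hCc : Convex ℝ C := by
    rintro y ⟨t, ht⟩ z ⟨s, hs⟩ a b ha hb hab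
    refine ⟨a * t + b * s, ?_⟩
    have := hconv.interior ht hs ha hb hab
    convert this using 1
    module
  have hC0 : C ∈ 𝓝 (0 : EuclideanSpace ℝ (Fin n)) := hCo.mem_nhds (hKC h0)
  have habs : Absorbent ℝ C := absorbent_nhds_zero hC0
  have hlt : ∀ y, gauge C y < 1 ↔ y ∈ C := fun y => by
    rw [gauge_lt_one_iff_mem_interior hCc hC0, hCo.interior_eq]
  have hsm : ∀ (c : ℝ) y, 0 ≤ c → gauge C (c • y) = c * gauge C y := fun c y hc => by
    rw [gauge_smul_of_nonneg hc, smul_eq_mul]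
  have hgx : ∀ t : ℝ, gauge C (t • x) = 0 := by
    intro t
    by_contra hne
    have hpos : 0 < gauge C (t • x) := lt_of_le_of_ne (gauge_nonneg _) (Ne.symm hne)
    have h1 : gauge C ((gauge C (t • x))⁻¹ • (t • x)) = 1 := by
      rw [hsm _ _ (by positivity)]; field_simp
    have h2 : (gauge C (t • x))⁻¹ • (t • x) ∈ C :=
      ⟨-((gauge C (t • x))⁻¹ * t), by rw [smul_smul, ← add_smul]; simpa using h0⟩
    have := (hlt _).2 h2
    linarith
  refine ⟨gauge C, continuous_gauge hCc hC0, hlt, hsm, ?_, ?_, fun y => gauge_nonneg _⟩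
  · intro y t
    apply le_antisymm
    · have := gauge_add_le hCc habs y (t • x)
      rw [hgx] at this; linarith
    · have := gauge_add_le hCc habs (y + t • x) ((-t) • x)
      rw [hgx] at this
      have e : y + t • x + (-t) • x = y := by module
      rw [e] at this; linarith
  · intro y hy
    rw [gauge_le_one_iff_mem_closure hCc hC0]
    have : closure (interior K) = closure K :=
      hconv.closure_interior_eq_closure_of_nonempty_interior ⟨0, h0⟩
    exact closure_mono hKC (this ▸ subset_closure hy)

lemma shadow_eq {n : ℕ} (K : Set (EuclideanSpace ℝ (Fin n)))
    (x : EuclideanSpace ℝ (Fin n)) (hK : IsCompact K)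
    (p : EuclideanSpace ℝ (Fin n) → ℝ)
    (hlt : ∀ y, p y < 1 ↔ ∃ t : ℝ, y + t • x ∈ interior K)
    (hle : ∀ y ∈ K, p y ≤ 1) (y : EuclideanSpace ℝ (Fin n)) :
    y ∈ shadowBoundary K x ↔ y ∈ K ∧ p y = 1 := by
  constructor
  · rintro ⟨h1, -, h3⟩
    have hyK := hK.isClosed.frontier_subset h1
    refine ⟨hyK, le_antisymm (hle y hyK) ?_⟩
    by_contra h
    obtain ⟨t, ht⟩ := (hlt y).1 (not_le.1 h)
    exact h3 t ht
  · rintro ⟨h1, h2⟩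
    have h3 : ∀ t : ℝ, y + t • x ∉ interior K := fun t ht => by
      have := (hlt y).2 ⟨t, ht⟩; linarith
    refine ⟨?_, ⟨0, by simpa using h1⟩, h3⟩
    rw [frontier, hK.isClosed.closure_eq]
    exact ⟨h1, by simpa using h3 0⟩

theorem core_contra {n : ℕ} [NeZero (n - 1)] (K : Set (EuclideanSpace ℝ (Fin n)))
    (x : EuclideanSpace ℝ (Fin n)) (hK : IsCompact K) (hconv : Convex ℝ K)
    (h0 : 0 ∈ interior K) (hx : x ≠ 0)
    (hman : Nonempty (ChartedSpace (EuclideanHalfSpace (n - 1)) ↥(shadowBoundary K x)))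
    (P : EuclideanSpace ℝ (Fin n)) (hP : P ∈ shadowBoundary K x)
    (hPQ : ∀ Q : shadowBoundary K x, (∃ s : ℝ, (Q : EuclideanSpace ℝ (Fin n)) = P + s • x) →
      Q ∉ chartInterior (n - 1) (shadowBoundary K x)) : False := by
  obtain ⟨p, hpc, hlt, hsm, htr, hle, hnn⟩ := exists_cyl_gauge K x hconv h0
  have hSiff := shadow_eq K x hK p hlt hle
  set S := shadowBoundary K x with hSdef
  have hSc : IsClosed S := by
    have : S = K ∩ {y | p y = 1} := by ext y; exact hSiff y
    rw [this]
    exact hK.isClosed.inter (isClosed_eq hpc continuous_const)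
  have hSK : S ⊆ K := fun y hy => ((hSiff y).1 hy).1
  have hScomp : IsCompact S := hK.of_isClosed_subset hSc hSK
  have : CompactSpace S := isCompact_iff_compactSpace.1 hScomp
  have hxx : 0 < inner ℝ x x := real_inner_self_pos.2 hx
  set q : EuclideanSpace ℝ (Fin n) := P + (-(inner ℝ x P / inner ℝ x x)) • x with hq
  have hxq : inner ℝ x q = 0 := by
    rw [hq, inner_add_right, inner_smul_right]; field_simp; ring
  have hqx : inner ℝ q x = 0 := by rw [real_inner_comm]; exact hxq
  have hpq : p q = 1 := by rw [hq, htr]; exact ((hSiff P).1 hP).2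
  have hp0 : p 0 = 0 := by simpa using hsm 0 0 le_rfl
  have hq0 : q ≠ 0 := by
    intro h; rw [h, hp0] at hpq; norm_num at hpq
  have hqq : 0 < inner ℝ q q := real_inner_self_pos.2 hq0
  let U : Submodule ℝ (EuclideanSpace ℝ (Fin n)) := Submodule.span ℝ {x, q}
  let W := Uᗮ
  have hxU : x ∈ U := Submodule.subset_span (by simp)
  have hqU : q ∈ U := Submodule.subset_span (by simp)
  have hbx : ∀ b : W, inner ℝ x (b : EuclideanSpace ℝ (Fin n)) = 0 := fun b =>
    (Submodule.mem_orthogonal U _).1 b.2 x hxU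
  have hbq : ∀ b : W, inner ℝ q (b : EuclideanSpace ℝ (Fin n)) = 0 := fun b =>
    (Submodule.mem_orthogonal U _).1 b.2 q hqU
  let pr : EuclideanSpace ℝ (Fin n) →L[ℝ] W := W.orthogonalProjectionOnto
  have hprU : ∀ u ∈ U, pr u = 0 := by
    intro u hu
    rw [Submodule.orthogonalProjectionOnto_eq_zero_iff]
    exact Submodule.le_orthogonal_orthogonal U hu
  have hprW : ∀ b : W, pr (b : EuclideanSpace ℝ (Fin n)) = b := fun b =>
    Submodule.orthogonalProjectionOnto_mem_subspace_eq_self b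
  have hpr0 : ∀ y, pr y = 0 → ∃ α β : ℝ, α • x + β • q = y := by
    intro y hy
    rw [Submodule.orthogonalProjectionOnto_eq_zero_iff] at hy
    rw [Submodule.orthogonal_orthogonal] at hy
    exact Submodule.mem_span_pair.1 hy
  let N : Set S := {y | ‖pr y‖ * inner ℝ q q < inner ℝ q (y : EuclideanSpace ℝ (Fin n))}
  have hN : IsOpen N := isOpen_lt (by fun_prop) (by fun_prop)
  let F : Set S := {y | (y : EuclideanSpace ℝ (Fin n)) - q ∈ Submodule.span ℝ {x}}
  have hF : IsCompact F := by
    apply IsClosed.isCompact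
    exact (Submodule.closed_of_finiteDimensional _).preimage (f := fun y : S =>
      (y : EuclideanSpace ℝ (Fin n)) - q) (by fun_prop)
  have hFx : ∀ y ∈ F, ∃ s : ℝ, (y : EuclideanSpace ℝ (Fin n)) = q + s • x := by
    intro y hy
    obtain ⟨s, hs⟩ := Submodule.mem_span_singleton.1 hy
    exact ⟨s, by rw [hs]; abel⟩
  have hFN : F ⊆ N := by
    intro y hy
    obtain ⟨s, hs⟩ := hFx y hy
    have h1 : pr (y : EuclideanSpace ℝ (Fin n)) = 0 :=
      hprU _ (by rw [hs]; exact U.add_mem hqU (U.smul_mem _ hxU))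
    have h2 : inner ℝ q (y : EuclideanSpace ℝ (Fin n)) = inner ℝ q q := by
      rw [hs, inner_add_right, inner_smul_right, hqx]; ring
    change ‖pr (y : EuclideanSpace ℝ (Fin n))‖ * inner ℝ q q < inner ℝ q (y : EuclideanSpace ℝ (Fin n))
    rw [h1, h2]; simpa using hqq
  obtain ⟨cs⟩ := hman
  obtain ⟨φ, hφc, hφ1, hφ2, hφ3, hφ4⟩ := push_off (m := n - 1) N hN F hF hFN
  have hFni : ∀ y ∈ F, y ∉ chartInterior (n - 1) S := by
    intro y hy
    obtain ⟨s, hs⟩ := hFx y hy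
    refine hPQ y ⟨-(inner ℝ x P / inner ℝ x x) + s, ?_⟩
    rw [hs, hq]; module
  have hφF : ∀ y, φ y ∉ F := by
    intro y hy
    rcases hφ3 y with h | h
    · rw [h] at hy
      have := hφ4 y hy
      rw [h] at this
      exact hFni y hy this
    · exact hFni _ hy h
  have hne : ∀ y : S, 0 < inner ℝ q (y : EuclideanSpace ℝ (Fin n)) →
      pr (φ y : EuclideanSpace ℝ (Fin n)) ≠ 0 := by
    intro y hy h
    have hpos : 0 < inner ℝ q (φ y : EuclideanSpace ℝ (Fin n)) := by
      by_cases hyN : y ∈ N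
      · have h3 : ‖pr (φ y : EuclideanSpace ℝ (Fin n))‖ * inner ℝ q q <
          inner ℝ q (φ y : EuclideanSpace ℝ (Fin n)) := hφ2 y hyN
        exact lt_of_le_of_lt (by positivity) h3
      · rw [hφ1 y hyN]; exact hy
    obtain ⟨α, β, hab⟩ := hpr0 _ h
    have hβ : 0 < β := by
      rw [← hab, inner_add_right, inner_smul_right, inner_smul_right, hqx] at hpos
      by_contra hc
      nlinarith [not_lt.1 hc]
    have h1 : p (φ y : EuclideanSpace ℝ (Fin n)) = β := by
      rw [← hab, add_comm, htr, hsm _ _ hβ.le, hpq, mul_one]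
    have h2 : β = 1 := by rw [← h1]; exact ((hSiff _).1 (φ y).2).2
    apply hφF y
    change (φ y : EuclideanSpace ℝ (Fin n)) - q ∈ Submodule.span ℝ {x}
    rw [← hab, h2]
    refine Submodule.mem_span_singleton.2 ⟨α, by module⟩
  obtain ⟨H, hH⟩ := ContinuousMap.exists_restrict_eq hSc
    (⟨fun y : S => pr (φ y : EuclideanSpace ℝ (Fin n)), by fun_prop⟩ : C(S, W))
  have hHS : ∀ y : S, H (y : EuclideanSpace ℝ (Fin n)) = pr (φ y : EuclideanSpace ℝ (Fin n)) :=
    fun y => congrArg (fun g : C(S, W) => g y) hH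
  obtain ⟨R, hR⟩ := hK.isBounded.exists_norm_le
  have hppos : ∀ b : W, 0 < p (q + b) := by
    intro b
    refine lt_of_le_of_ne (hnn _) fun h => ?_
    have hs : ∀ s : ℝ, 0 ≤ s → s * inner ℝ q q ≤ ‖q‖ * R := by
      intro s hs
      have h1 : p (s • (q + b)) < 1 := by rw [hsm _ _ hs, ← h]; norm_num
      obtain ⟨t, ht⟩ := (hlt _).1 h1
      have h2 := hR _ (interior_subset ht)
      have h3 := real_inner_le_norm q (s • (q + (b : EuclideanSpace ℝ (Fin n))) + t • x)
      rw [inner_add_right, inner_smul_right, inner_smul_right, inner_add_right, hqx, hbq] at h3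
      have h4 := mul_le_mul_of_nonneg_left h2 (norm_nonneg q)
      linarith
    have hR0 : 0 ≤ ‖q‖ * R := by simpa using hs 0 le_rfl
    have := hs ((‖q‖ * R + 1) / inner ℝ q q) (by positivity)
    rw [div_mul_cancel₀ _ hqq.ne'] at this
    linarith
  let σ : W → EuclideanSpace ℝ (Fin n) := fun b => (p (q + b))⁻¹ • (q + b)
  have hσc : Continuous σ := by
    have : Continuous fun b : W => p (q + b) := by fun_prop
    exact (this.inv₀ fun b => (hppos b).ne').smul (by fun_prop)
  have hσp : ∀ b, p (σ b) = 1 := by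
    intro b
    rw [hsm _ _ (inv_nonneg.2 (hppos b).le)]
    exact inv_mul_cancel₀ (hppos b).ne'
  have hex : ∀ k : ℕ, ∃ s : C(W, ℝ), ∀ b, ((1 - 1 / ((k : ℝ) + 2)) • σ b + s b • x) ∈ interior K := by
    intro k
    have hη : 0 ≤ 1 - 1 / ((k : ℝ) + 2) := by
      rw [sub_nonneg, div_le_one (by positivity)]
      linarith [(Nat.cast_nonneg k : (0 : ℝ) ≤ k)]
    have hη2 : 1 - 1 / ((k : ℝ) + 2) < 1 := by
      have : 0 < 1 / ((k : ℝ) + 2) := by positivity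
      linarith
    refine exists_continuous_forall_mem_convex_of_local_const
      (t := fun b => {r : ℝ | (1 - 1 / ((k : ℝ) + 2)) • σ b + r • x ∈ interior K}) ?_ ?_
    · intro b r hr r' hr' a c ha hc hac
      have := hconv.interior hr hr' ha hc hac
      change _ ∈ interior K
      convert this using 1
      simp only [smul_eq_mul]
      have e : c = 1 - a := by linarith
      rw [e]; module
    · intro b
      have h1 : p ((1 - 1 / ((k : ℝ) + 2)) • σ b) < 1 := by
        rw [hsm _ _ hη, hσp, mul_one]; exact hη2
      obtain ⟨r, hr⟩ := (hlt _).1 h1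
      refine ⟨r, ?_⟩
      have hc : Continuous fun b' : W => (1 - 1 / ((k : ℝ) + 2)) • σ b' + r • x := by fun_prop
      exact hc.continuousAt.preimage_mem_nhds (isOpen_interior.mem_nhds hr)
  choose s hs using hex
  let Y : ℕ → W → EuclideanSpace ℝ (Fin n) := fun k b =>
    (1 - 1 / ((k : ℝ) + 2)) • σ b + s k b • x
  have hYc : ∀ k, Continuous (Y k) := fun k => by
    have := (s k).continuous
    fun_prop
  have hgood : ∃ k, ∀ b ∈ closedBall (0 : W) 1, H (Y k b) ≠ 0 ∧
      (‖b‖ = 1 → 0 < inner ℝ (H (Y k b)) b) := by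
    by_contra! hbad
    choose B hB1 hB2 using hbad
    have hcomp : IsCompact (closedBall (0 : W) 1 ×ˢ K) := (isCompact_closedBall _ _).prod hK
    obtain ⟨⟨b, y⟩, ⟨hb, hy⟩, θ, hθ, hlim⟩ := hcomp.tendsto_subseq
      (x := fun k => (B k, Y k (B k))) (fun k => ⟨hB1 k, interior_subset (hs k (B k))⟩)
    have hlb : Tendsto (fun k => B (θ k)) atTop (𝓝 b) :=
      (continuous_fst.tendsto _).comp hlim
    have hly : Tendsto (fun k => Y (θ k) (B (θ k))) atTop (𝓝 y) :=
      (continuous_snd.tendsto _).comp hlim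
    have hη : Tendsto (fun k => (1 - 1 / (((θ k : ℕ) : ℝ) + 2))) atTop (𝓝 1) := by
      have h1 : Tendsto (fun k : ℕ => 1 / ((k : ℝ) + 2)) atTop (𝓝 0) := by
        have := (tendsto_one_div_add_atTop_nhds_zero_nat (𝕜 := ℝ)).comp (tendsto_add_atTop_nat 1)
        refine this.congr fun k => ?_
        simp only [Function.comp]; push_cast; ring_nf
      have := (h1.comp hθ.tendsto_atTop).const_sub 1
      simpa using this
    have hησ : Tendsto (fun k => (1 - 1 / (((θ k : ℕ) : ℝ) + 2)) • σ (B (θ k))) atTop (𝓝 (σ b)) := by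
      have := hη.smul ((hσc.tendsto b).comp hlb)
      simpa using this
    have hpy : p y = 1 := by
      have h1 := (hpc.tendsto y).comp hly
      have h2 := (hpc.tendsto _).comp hησ
      rw [hσp] at h2
      refine tendsto_nhds_unique h1 (h2.congr fun k => ?_)
      simp only [Function.comp, Y, htr]
    have hyS : y ∈ S := (hSiff y).2 ⟨hy, hpy⟩
    have hpry : pr y = (p (q + b))⁻¹ • b := by
      have h1 := (pr.continuous.tendsto y).comp hly
      have h2 := (pr.continuous.tendsto _).comp hησ
      have h3 : pr (σ b) = (p (q + b))⁻¹ • b := by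
        simp only [σ, map_smul, map_add, hprU q hqU, hprW, zero_add]
      rw [h3] at h2
      refine tendsto_nhds_unique h1 (h2.congr fun k => ?_)
      simp only [Function.comp, Y, map_add, map_smul, hprU x hxU, smul_zero, add_zero]
    have hiny : inner ℝ q y = (p (q + b))⁻¹ * inner ℝ q q := by
      have hic : Continuous fun z : EuclideanSpace ℝ (Fin n) => inner ℝ q z := by fun_prop
      have h1 := (hic.tendsto y).comp hly
      have h2 := (hic.tendsto _).comp hησ
      have h3 : inner ℝ q (σ b) = (p (q + b))⁻¹ * inner ℝ q q := by
        simp only [σ, inner_smul_right, inner_add_right, hbq, add_zero]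
      rw [h3] at h2
      refine tendsto_nhds_unique h1 (h2.congr fun k => ?_)
      simp only [Function.comp, Y, inner_add_right, inner_smul_right, hqx, mul_zero, add_zero]
    have hpb := inv_pos.2 (hppos b)
    have hHne : H y ≠ 0 := by
      have := hHS ⟨y, hyS⟩
      rw [this]
      exact hne ⟨y, hyS⟩ (by rw [hiny]; positivity)
    have hclosed : IsClosed {z : W × EuclideanSpace ℝ (Fin n) |
        H z.2 = 0 ∨ (‖z.1‖ = 1 ∧ inner ℝ (H z.2) z.1 ≤ 0)} := by
      have hHc := H.continuous
      have c1 : IsClosed {z : W × EuclideanSpace ℝ (Fin n) | H z.2 = 0} :=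
        isClosed_eq (by fun_prop) continuous_const
      have c2 : IsClosed {z : W × EuclideanSpace ℝ (Fin n) | ‖z.1‖ = 1} :=
        isClosed_eq (by fun_prop) continuous_const
      have c3 : IsClosed {z : W × EuclideanSpace ℝ (Fin n) | inner ℝ (H z.2) z.1 ≤ 0} :=
        isClosed_le (by fun_prop) continuous_const
      exact c1.union (c2.inter c3)
    have hmem := hclosed.mem_of_tendsto hlim (Eventually.of_forall fun k => by
      by_cases hz : H (Y (θ k) (B (θ k))) = 0
      · exact Or.inl hz
      · exact Or.inr (hB2 (θ k) hz))
    rcases hmem with h | ⟨h1, h2⟩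
    · exact hHne h
    · have h1 : ‖b‖ = 1 := h1
      have h2 : inner ℝ (H y) b ≤ 0 := h2
      have hyN : (⟨y, hyS⟩ : S) ∉ N := by
        intro h
        have h : ‖pr y‖ * inner ℝ q q < inner ℝ q y := h
        rw [hpry, hiny, norm_smul, h1, mul_one, Real.norm_of_nonneg hpb.le] at h
        exact lt_irrefl _ h
      have h3 := hHS ⟨y, hyS⟩
      rw [hφ1 _ hyN] at h3
      have h3 : H y = pr y := h3
      rw [h3, hpry, real_inner_smul_left, real_inner_self_eq_norm_sq, h1] at h2
      nlinarith
  obtain ⟨k, hk⟩ := hgood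
  obtain ⟨b, hb, hb0⟩ := exists_zero_of_inner_pos (fun b => H (Y k b))
    (H.continuous.comp (hYc k)).continuousOn
    (fun b hb => (hk b (by simp [hb])).2 hb)
  exact (hk b hb).1 hb0

end CorePart

section MainPart

open Topology Filter

lemma line_interior {n : ℕ} (K : Set (EuclideanSpace ℝ (Fin n)))
    (x u : EuclideanSpace ℝ (Fin n)) (hconv : Convex ℝ K) (α β γ : ℝ)
    (hα : u + α • x ∈ interior K) (hβ : u + β • x ∈ K)
    (h : (α ≤ γ ∧ γ < β) ∨ (β < γ ∧ γ ≤ α)) : u + γ • x ∈ interior K := by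
  have hne : β - α ≠ 0 := by rcases h with h | h <;> intro h' <;> linarith
  have key : ∀ a b : ℝ, 0 < a → 0 ≤ b → a + b = 1 → a * α + b * β = γ → u + γ • x ∈ interior K := by
    intro a b ha hb hab hg
    have := hconv.combo_interior_self_mem_interior hα hβ ha hb hab
    convert this using 1
    rw [← hg]
    have e : b = 1 - a := by linarith
    rw [e]; module
  refine key ((β - γ) / (β - α)) ((γ - α) / (β - α)) ?_ ?_ ?_ ?_
  · rcases h with h | h
    · exact div_pos (by linarith) (by linarith)
    · exact div_pos_of_neg_of_neg (by linarith) (by linarith)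
  · rcases h with h | h
    · exact div_nonneg (by linarith) (by linarith)
    · exact div_nonneg_of_nonpos (by linarith) (by linarith)
  · field_simp; ring
  · field_simp; ring

lemma chord_bounds {n : ℕ} (K : Set (EuclideanSpace ℝ (Fin n)))
    (x y : EuclideanSpace ℝ (Fin n)) (hK : IsCompact K) (hconv : Convex ℝ K) (r : ℝ) (hr : 0 < r)
    (h1 : y ∈ frontier K) (h2 : y + (-r) • x ∈ frontier K) (h3 : ∃ τ : ℝ, y + τ • x ∈ interior K)
    (t : ℝ) (ht : y + t • x ∈ K) : -r ≤ t ∧ t ≤ 0 := by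
  obtain ⟨τ, hτ⟩ := h3
  have k1 : y + (0 : ℝ) • x ∈ K := by simpa using hK.isClosed.frontier_subset h1
  have n1 : y + (0 : ℝ) • x ∉ interior K := by simpa using h1.2
  have k2 : y + (-r) • x ∈ K := hK.isClosed.frontier_subset h2
  have n2 : y + (-r) • x ∉ interior K := h2.2
  have e1 : τ < 0 := by
    by_contra hc
    exact n1 (line_interior K x y hconv τ (-r) 0 hτ k2 (Or.inr ⟨by linarith, not_lt.1 hc⟩))
  have e2 : -r < τ := by
    by_contra hc
    exact n2 (line_interior K x y hconv τ 0 (-r) hτ k1 (Or.inl ⟨not_lt.1 hc, by linarith⟩))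
  constructor
  · by_contra hc
    exact n2 (line_interior K x y hconv τ t (-r) hτ ht (Or.inr ⟨not_le.1 hc, e2.le⟩))
  · by_contra hc
    exact n1 (line_interior K x y hconv τ t 0 hτ ht (Or.inl ⟨e1.le, not_le.1 hc⟩))

lemma crossing {n : ℕ} (K : Set (EuclideanSpace ℝ (Fin n)))
    (z o : EuclideanSpace ℝ (Fin n)) (hz : z ∈ interior K) (ho : o ∉ interior K) :
    ∃ e ∈ segment ℝ z o, e ∈ frontier K := by
  by_contra! hcon
  have hpre : IsPreconnected (segment ℝ z o) := (convex_segment z o).isPreconnected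
  have hd : Disjoint (segment ℝ z o) (frontier (interior K)) := by
    rw [Set.disjoint_left]
    exact fun e he hf => hcon e he (frontier_interior_subset hf)
  have h1 : segment ℝ z o ⊆ interior K := by
    refine hpre.subset_left_of_subset_union isOpen_interior
      (isClosed_closure (s := interior K)).isOpen_compl ?_ ?_ ⟨z, left_mem_segment ℝ z o, hz⟩
    · exact Set.disjoint_left.2 fun e he hf => hf (subset_closure he)
    · intro e he
      by_cases hc : e ∈ closure (interior K)
      · left
        by_contra hni
        refine Set.disjoint_left.1 hd he ⟨hc, ?_⟩
        rwa [interior_interior]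
      · exact Or.inr hc
  exact ho (h1 (right_mem_segment ℝ z o))

lemma paramSphere_mem {n : ℕ} (K : Set (EuclideanSpace ℝ (Fin n)))
    (x : EuclideanSpace ℝ (Fin n)) (lam : ℝ) (hl : 0 < lam) (y : EuclideanSpace ℝ (Fin n))
    (hy : y ∈ paramSphere K x lam) : y ∈ frontier K ∧ y + (-lam⁻¹) • x ∈ frontier K := by
  have f1 : frontier (lam • K) = lam • frontier K :=
    ((Homeomorph.smulOfNeZero lam hl.ne').image_frontier K).symm
  have f2 : frontier (x +ᵥ lam • K) = x +ᵥ frontier (lam • K) :=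
    ((Homeomorph.addLeft x).image_frontier (lam • K)).symm
  unfold paramSphere at hy
  rw [f2, f1] at hy
  obtain ⟨w, ⟨⟨a, ha, rfl⟩, ⟨b', ⟨b, hb, rfl⟩, hab⟩⟩, rfl⟩ := hy
  have hab : x + lam • b = lam • a := hab
  have e : lam⁻¹ • lam • a = a := inv_smul_smul₀ hl.ne' a
  refine ⟨by simpa [e] using ha, ?_⟩
  have e2 : b = lam⁻¹ • lam • a + (-lam⁻¹) • x := by
    rw [← hab, smul_add, inv_smul_smul₀ hl.ne']; module
  change lam⁻¹ • lam • a + (-lam⁻¹) • x ∈ frontier K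
  rw [← e2]; exact hb

end MainPart

theorem paramSphere_subset_shadowBoundary_of_manifoldWithBoundary {n : ℕ}
    [NeZero (n - 1)] (K : Set (EuclideanSpace ℝ (Fin n)))
    (x : EuclideanSpace ℝ (Fin n)) (hK : IsCompact K) (hconv : Convex ℝ K)
    (hint : (interior K).Nonempty) (hsymm : ∀ y ∈ K, -y ∈ K) (hx : x ≠ 0)
    -- `S(K,x)` is an (n-1)-dimensional topological manifold with boundary:
    (hman : Nonempty (ChartedSpace (EuclideanHalfSpace (n - 1))
      ↥(shadowBoundary K x))) :
    ∃ lam : ℝ, lambda0 K x < lam ∧ paramSphere K x lam ⊆ shadowBoundary K x := by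
  have h0 : (0 : EuclideanSpace ℝ (Fin n)) ∈ interior K := by
    obtain ⟨z, hz⟩ := hint
    have := hconv.combo_interior_self_mem_interior hz (hsymm z (interior_subset hz))
      (a := 1 / 2) (b := 1 / 2) (by norm_num) (by norm_num) (by norm_num)
    simpa using this
  by_contra! hcon
  obtain ⟨p, hpc, hlt, hsm, htr, hle, hnn⟩ := exists_cyl_gauge K x hconv h0
  have hSiff := shadow_eq K x hK p hlt hle
  have hl0 : 0 ≤ lambda0 K x := Real.sSup_nonneg fun t ht => ht.1.le
  have hseq : ∀ k : ℕ, ∃ y, y ∈ frontier K ∧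
      y + (-(lambda0 K x + (k + 1))⁻¹) • x ∈ frontier K ∧ p y < 1 := by
    intro k
    obtain ⟨y, hy, hyS⟩ := Set.not_subset.1 (hcon (lambda0 K x + (k + 1)) (by
      have : (0 : ℝ) < k + 1 := by positivity
      linarith))
    obtain ⟨h1, h2⟩ := paramSphere_mem K x _ (by positivity) y hy
    refine ⟨y, h1, h2, lt_of_le_of_ne (hle y (hK.isClosed.frontier_subset h1)) fun h => ?_⟩
    exact hyS ((hSiff y).2 ⟨hK.isClosed.frontier_subset h1, h⟩)
  choose y' hy1' hy2' hy3' using hseq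
  have hfc : IsCompact (frontier K) :=
    hK.of_isClosed_subset isClosed_frontier hK.isClosed.frontier_subset
  obtain ⟨P, hPf, θ, hθ, hlim⟩ := hfc.tendsto_subseq hy1'
  have hPK := hK.isClosed.frontier_subset hPf
  have hr' : Filter.Tendsto (fun k : ℕ => (lambda0 K x + ((k : ℝ) + 1))⁻¹) Filter.atTop (nhds 0) := by
    apply Filter.Tendsto.inv_tendsto_atTop
    apply Filter.tendsto_atTop_add_const_left
    apply Filter.tendsto_atTop_add_const_right
    exact tendsto_natCast_atTop_atTop
  obtain ⟨y, hydef⟩ : ∃ y, y = fun k => y' (θ k) := ⟨_, rfl⟩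
  obtain ⟨r, hrdef⟩ : ∃ r : ℕ → ℝ, r = fun k => (lambda0 K x + ((θ k : ℝ) + 1))⁻¹ := ⟨_, rfl⟩
  have hy1 : ∀ k, y k ∈ frontier K := fun k => by rw [hydef]; exact hy1' _
  have hy2 : ∀ k, y k + (-(r k)) • x ∈ frontier K := fun k => by rw [hydef, hrdef]; exact hy2' _
  have hy3 : ∀ k, p (y k) < 1 := fun k => by rw [hydef]; exact hy3' _
  have hylim : Filter.Tendsto y Filter.atTop (nhds P) := by rw [hydef]; exact hlim
  have hrpos : ∀ k, 0 < r k := fun k => by rw [hrdef]; positivity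
  have hrlim : Filter.Tendsto r Filter.atTop (nhds 0) := by
    rw [hrdef]; exact hr'.comp hθ.tendsto_atTop
  have hch : ∀ k t, y k + t • x ∈ K → -(r k) ≤ t ∧ t ≤ 0 := fun k t ht =>
    chord_bounds K x (y k) hK hconv (r k) (hrpos k) (hy1 k) (hy2 k) ((hlt _).1 (hy3 k)) t ht
  have hPS : P ∈ shadowBoundary K x := by
    refine (hSiff P).2 ⟨hPK, le_antisymm (hle P hPK) ?_⟩
    by_contra hc
    obtain ⟨τ, hτ⟩ := (hlt P).1 (not_le.1 hc)
    have h1 : Filter.Tendsto (fun k => y k + τ • x) Filter.atTop (nhds (P + τ • x)) :=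
      hylim.add_const _
    have h2 := h1.eventually (isOpen_interior.mem_nhds hτ)
    have h3 : ∀ᶠ k in Filter.atTop, -(r k) ≤ τ ∧ τ ≤ 0 :=
      h2.mono fun k hk => hch k τ (interior_subset hk)
    have h4 : τ ≤ 0 := by
      obtain ⟨k, hk⟩ := h3.exists
      exact hk.2
    have h5 : 0 ≤ τ := by
      have := hrlim.neg
      rw [neg_zero] at this
      exact le_of_tendsto this (h3.mono fun k hk => hk.1)
    have h6 : τ = 0 := le_antisymm h4 h5
    rw [h6] at hτ
    exact hPf.2 (by simpa using hτ)
  refine core_contra K x hK hconv h0 hx hman P hPS ?_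
  rintro Q ⟨s, hQs⟩ hQc
  have hSf : shadowBoundary K x ⊆ frontier K := fun z hz => hz.1
  have hev := interior_of_chartInterior K (shadowBoundary K x) hconv h0 hSf Q hQc
  obtain ⟨ε, hε, hball⟩ := Metric.eventually_nhds_iff_ball.1 hev
  obtain ⟨z, hzb, hz⟩ : ∃ z ∈ ball (Q : EuclideanSpace ℝ (Fin n)) ε, z ∈ interior K := by
    have h1 : closure (interior K) = closure K :=
      hconv.closure_interior_eq_closure_of_nonempty_interior ⟨0, h0⟩
    have h2 : (Q : EuclideanSpace ℝ (Fin n)) ∈ closure (interior K) :=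
      h1 ▸ subset_closure ((hSiff _).1 Q.2).1
    obtain ⟨z, hz1, hz2⟩ := mem_closure_iff_nhds.1 h2 _ (ball_mem_nhds _ hε)
    exact ⟨z, hz1, hz2⟩
  obtain ⟨o, hob, ho, hop⟩ : ∃ o ∈ ball (Q : EuclideanSpace ℝ (Fin n)) ε,
      o ∉ interior K ∧ p o < 1 := by
    rcases lt_or_ge s 0 with hs | hs
    · have h1 : Filter.Tendsto (fun k => y k + (-(r k) + s) • x) Filter.atTop
          (nhds (Q : EuclideanSpace ℝ (Fin n))) := by
        have := hylim.add ((hrlim.neg.add_const s).smul_const x)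
        rw [hQs]
        simpa using this
      obtain ⟨k, hk⟩ := (h1.eventually (ball_mem_nhds _ hε)).exists
      refine ⟨_, hk, fun h => ?_, by rw [htr]; exact hy3 k⟩
      have := (hch k _ (interior_subset h)).1
      linarith
    · have h1 : Filter.Tendsto (fun k => y k + s • x) Filter.atTop
          (nhds (Q : EuclideanSpace ℝ (Fin n))) := by
        rw [hQs]
        exact hylim.add_const _
      obtain ⟨k, hk⟩ := (h1.eventually (ball_mem_nhds _ hε)).exists
      refine ⟨_, hk, fun h => ?_, by rw [htr]; exact hy3 k⟩
      have h2 := (hch k _ (interior_subset h)).2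
      have h3 : s = 0 := le_antisymm h2 hs
      rw [h3] at h
      exact (hy1 k).2 (by simpa using h)
  obtain ⟨e, he, hef⟩ := crossing K z o hz ho
  have heS := hball e ((convex_ball _ _).segment_subset hzb hob he) hef
  have hep := ((hSiff e).1 heS).2
  obtain ⟨t, ht⟩ := (hlt o).1 hop
  obtain ⟨a, b, ha, hb, hab, rfl⟩ := he
  have : p (a • z + b • o) < 1 := by
    refine (hlt _).2 ⟨b * t, ?_⟩
    have := hconv.interior hz ht ha hb hab
    convert this using 1
    module
  linarith
end
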